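/- Assume the Riemann Hypothesis for the Riemann zeta function. Let w : ℝ → ℝ be an even Schwartz function. For every ε > 0 there exists a constant C > 0, depending only on ε and w, such that for every positive integer N, every real X ≥ 1, and every odd positive integer n that is not a perfect square, one has |∑_{d ∈ ℤ, d squarefree, gcd(d,N)=1} w(d/X) · (d/n)| ≤ C · N^{ε} · n^{3/8+ε} · X^{1/4+ε}. -/

import Mathlib

open scoped Classical

noncomputable def hz : ℂ → ℂ := Function.update (fun s => (s-1)*riemannZeta s) 1 1

lemma hz_of_ne {s : ℂ} (hs : s ≠ 1) : hz s = (s-1)*riemannZeta s := by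
  simp [hz, Function.update_of_ne hs]

lemma hz_one : hz 1 = 1 := by simp [hz]

lemma hz_diff : Differentiable ℂ hz := by
  intro s
  have h1 : ∀ s : ℂ, s ≠ 1 → DifferentiableAt ℂ hz s := by
    intro s hs
    have : DifferentiableAt ℂ (fun s => (s-1)*riemannZeta s) s :=
      DifferentiableAt.mul (by fun_prop) (differentiableAt_riemannZeta hs)
    refine this.congr_of_eventuallyEq ?_
    filter_upwards [isOpen_ne.mem_nhds hs] with z hz using hz_of_ne hz
  by_cases hs : s = 1
  · subst hs
    refine (Complex.analyticAt_of_differentiable_on_punctured_nhds_of_continuousAt ?_ ?_).differentiableAt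
    · exact Filter.eventually_of_mem self_mem_nhdsWithin fun z hz => h1 z hz
    · exact continuousAt_update_same.mpr riemannZeta_residue_one
  · exact h1 s hs

noncomputable def frI : ℝ → ℂ := Set.indicator (Set.Ioi 1) (fun t => ((Int.fract t : ℝ) : ℂ))

lemma frI_norm_le (t : ℝ) : ‖frI t‖ ≤ 1 := by
  unfold frI
  by_cases h : t ∈ Set.Ioi (1:ℝ)
  · rw [Set.indicator_of_mem h]
    simp only [Complex.norm_real, Real.norm_eq_abs, Int.abs_fract]
    exact (Int.fract_lt_one t).le
  · rw [Set.indicator_of_notMem h]; simp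

lemma frI_meas : Measurable frI := by
  unfold frI
  refine Measurable.indicator ?_ measurableSet_Ioi
  exact Complex.measurable_ofReal.comp measurable_fract

lemma frI_locInt : MeasureTheory.LocallyIntegrableOn frI (Set.Ioi 0) := by
  have : MeasureTheory.LocallyIntegrable (fun _ : ℝ => (1:ℝ)) := MeasureTheory.locallyIntegrable_const _
  refine (MeasureTheory.LocallyIntegrable.mono this frI_meas.aestronglyMeasurable ?_).locallyIntegrableOn _
  filter_upwards with t
  simpa using frI_norm_le t

lemma frI_top : frI =O[Filter.atTop] (fun x : ℝ => x ^ (-(0:ℝ))) := by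
  refine Asymptotics.IsBigO.of_bound 1 ?_
  filter_upwards with t
  simpa using frI_norm_le t

lemma frI_bot (b : ℝ) : frI =O[nhdsWithin 0 (Set.Ioi 0)] (fun x : ℝ => x ^ (-b)) := by
  refine Asymptotics.IsBigO.of_bound 1 ?_
  have : Set.Iio (1:ℝ) ∈ nhdsWithin (0:ℝ) (Set.Ioi 0) :=
    mem_nhdsWithin_of_mem_nhds (Iio_mem_nhds one_pos)
  filter_upwards [this] with t ht
  have : frI t = 0 := by
    unfold frI
    rw [Set.indicator_of_notMem]
    simp only [Set.mem_Ioi, not_lt]; exact (Set.mem_Iio.mp ht).le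
  rw [this]; simp

lemma frM_diff {s : ℂ} (hs : 0 < s.re) : DifferentiableAt ℂ (fun s => mellin frI (-s)) s := by
  have := mellin_differentiableAt_of_isBigO_rpow (s := -s) (b := (-s).re - 1) frI_locInt frI_top (by simpa using hs)
    (frI_bot _) (by linarith)
  exact this.comp s (by fun_prop)

lemma frM_eq (s : ℂ) : mellin frI (-s) = ∫ t in Set.Ioi (1:ℝ), (t:ℂ)^(-(s+1)) * ((Int.fract t : ℝ) : ℂ) := by
  unfold mellin
  have : (fun t : ℝ => (t:ℂ)^(-s-1) • frI t) = Set.indicator (Set.Ioi 1) (fun t : ℝ => (t:ℂ)^(-(s+1)) * ((Int.fract t : ℝ) : ℂ)) := by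
    ext t
    unfold frI
    by_cases h : t ∈ Set.Ioi (1:ℝ)
    · rw [Set.indicator_of_mem h, Set.indicator_of_mem h, smul_eq_mul]
      congr 2; ring
    · rw [Set.indicator_of_notMem h, Set.indicator_of_notMem h]; simp
  rw [this, MeasureTheory.setIntegral_indicator measurableSet_Ioi]
  congr 2
  rw [Set.Ioi_inter_Ioi]; simp

lemma frM_norm {s : ℂ} (hs : 1/2 < s.re) : ‖mellin frI (-s)‖ ≤ 2 := by
  rw [frM_eq]
  have h2 : ∫ t in Set.Ioi (1:ℝ), t^(-(3/2:ℝ)) = 2 := by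
    rw [integral_Ioi_rpow_of_lt (by norm_num) one_pos]; norm_num
  rw [← h2]
  refine MeasureTheory.norm_integral_le_of_norm_le (integrableOn_Ioi_rpow_of_lt (by norm_num) one_pos) ?_
  filter_upwards [MeasureTheory.ae_restrict_mem measurableSet_Ioi] with t ht
  have ht' : (1:ℝ) < t := ht
  rw [norm_mul, Complex.norm_cpow_eq_rpow_re_of_pos (by linarith)]
  simp only [Complex.norm_real, Real.norm_eq_abs, Int.abs_fract]
  calc t ^ (-(s+1)).re * Int.fract t ≤ t ^ (-(s+1)).re * 1 := by
        gcongr; exact (Int.fract_lt_one t).le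
    _ ≤ _ := by
        rw [mul_one]
        apply Real.rpow_le_rpow_of_exponent_le ht'.le
        simp; linarith

lemma zeta_formula {s : ℂ} (hs : 1 < s.re) : hz s = s - s*(s-1)*mellin frI (-s) := by
  have hs1 : s ≠ 1 := by rintro rfl; simp at hs
  have hsm : s - 1 ≠ 0 := sub_ne_zero.mpr hs1
  have h0 : LSeries 1 s = s * ∫ t in Set.Ioi (1 : ℝ), (∑ k ∈ Finset.Icc 1 ⌊t⌋₊, (1:ℕ → ℂ) k) * t ^ (-(s + 1)) := by
    refine LSeries_eq_mul_integral' 1 (zero_le_one) hs ?_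
    simp only [Pi.one_apply, norm_one, Finset.sum_const, Nat.card_Icc, add_tsub_cancel_right, nsmul_eq_mul, mul_one, Real.rpow_one]
    exact Asymptotics.isBigO_refl _ _
  rw [LSeries_one_eq_riemannZeta hs] at h0
  rw [hz_of_ne hs1, h0, frM_eq]
  have h1 : ∫ t in Set.Ioi (1 : ℝ), (∑ k ∈ Finset.Icc 1 ⌊t⌋₊, (1:ℕ → ℂ) k) * t ^ (-(s + 1))
    = ∫ t in Set.Ioi (1 : ℝ), ((t:ℂ)^(-s) - (t:ℂ)^(-(s+1)) * ((Int.fract t : ℝ) : ℂ)) := by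
    refine MeasureTheory.setIntegral_congr_fun measurableSet_Ioi ?_
    intro t ht
    have ht' : (1:ℝ) < t := ht
    have ht0 : (t:ℂ) ≠ 0 := by exact_mod_cast (by linarith : t ≠ 0)
    simp only [Pi.one_apply, Finset.sum_const, Nat.card_Icc, add_tsub_cancel_right, nsmul_eq_mul, mul_one]
    have e1 : ((⌊t⌋₊ : ℕ) : ℂ) = (t:ℂ) - ((Int.fract t : ℝ):ℂ) := by
      have : ((⌊t⌋₊ : ℕ) : ℝ) = t - Int.fract t := by
        rw [natCast_floor_eq_intCast_floor (by linarith), Int.self_sub_fract]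
      rw [← Complex.ofReal_sub, ← this]; simp
    have e2 : (t:ℂ)^(-s) = (t:ℂ) * (t:ℂ)^(-(s+1)) := by
      rw [show -s = 1 + (-(s+1)) by ring, Complex.cpow_add _ _ ht0, Complex.cpow_one]
    rw [e1, e2]; ring
  rw [h1, MeasureTheory.integral_sub, integral_Ioi_cpow_of_lt (by simpa using hs) one_pos]
  · have : -s + 1 ≠ 0 := by intro h; apply hsm; linear_combination -h
    simp only [Complex.ofReal_one, Complex.one_cpow]
    field_simp
    ring
  · exact integrableOn_Ioi_cpow_of_lt (by simpa using hs) one_pos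
  · have hb : MeasureTheory.IntegrableOn (fun t : ℝ => t^(-(3/2:ℝ))) (Set.Ioi 1) := integrableOn_Ioi_rpow_of_lt (by norm_num) one_pos
    refine MeasureTheory.Integrable.mono' hb ?_ ?_
    · refine MeasureTheory.AEStronglyMeasurable.mul ?_ ?_
      · refine ContinuousOn.aestronglyMeasurable ?_ measurableSet_Ioi
        intro t ht
        have ht' : (1:ℝ) < t := ht
        refine ContinuousAt.continuousWithinAt ?_
        exact Complex.continuousAt_ofReal_cpow_const _ _ (Or.inr (by linarith))
      · exact (Complex.measurable_ofReal.comp measurable_fract).aestronglyMeasurable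
    · filter_upwards [MeasureTheory.ae_restrict_mem measurableSet_Ioi] with t ht
      have ht' : (1:ℝ) < t := ht
      rw [norm_mul, Complex.norm_cpow_eq_rpow_re_of_pos (by linarith)]
      simp only [Complex.norm_real, Real.norm_eq_abs, Int.abs_fract]
      calc t ^ (-(s+1)).re * Int.fract t ≤ t ^ (-(s+1)).re * 1 := by
            gcongr; exact (Int.fract_lt_one t).le
        _ ≤ _ := by
            rw [mul_one]
            apply Real.rpow_le_rpow_of_exponent_le ht'.le
            simp; linarith

lemma hz_formula {s : ℂ} (hs : 0 < s.re) : hz s = s - s*(s-1)*mellin frI (-s) := by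
  have hU : IsOpen {s : ℂ | 0 < s.re} := isOpen_lt continuous_const Complex.continuous_re
  have hconv : Convex ℝ {s : ℂ | 0 < s.re} := convex_halfSpace_re_gt 0
  have h1 : AnalyticOnNhd ℂ hz {s : ℂ | 0 < s.re} := (hz_diff.differentiableOn).analyticOnNhd hU
  have h2 : AnalyticOnNhd ℂ (fun s => s - s*(s-1)*mellin frI (-s)) {s : ℂ | 0 < s.re} := by
    refine DifferentiableOn.analyticOnNhd ?_ hU
    intro z hz
    refine DifferentiableAt.differentiableWithinAt ?_
    have := frM_diff hz
    fun_prop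
  refine h1.eqOn_of_preconnected_of_eventuallyEq h2 hconv.isPreconnected (z₀ := 2) (by simp) ?_ hs
  have : {s : ℂ | 1 < s.re} ∈ nhds (2:ℂ) := (isOpen_lt continuous_const Complex.continuous_re).mem_nhds (by simp)
  filter_upwards [this] with z hz using zeta_formula hz

lemma hz_norm_le {s : ℂ} (hs : 1/2 < s.re) : ‖hz s‖ ≤ 3 * (1+‖s‖)^2 := by
  rw [hz_formula (by linarith)]
  have h1 := frM_norm hs
  have h2 : ‖s - 1‖ ≤ ‖s‖ + 1 := by simpa using norm_sub_le s 1
  calc ‖s - s*(s-1)*mellin frI (-s)‖ ≤ ‖s‖ + ‖s‖*‖s-1‖*‖mellin frI (-s)‖ := by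
        refine (norm_sub_le _ _).trans ?_
        rw [norm_mul, norm_mul]
    _ ≤ ‖s‖ + ‖s‖*(‖s‖+1)*2 := by gcongr
    _ ≤ _ := by nlinarith [norm_nonneg s]

lemma hz_ne_zero (hRH : RiemannHypothesis) {s : ℂ} (hs : 1/2 < s.re) : hz s ≠ 0 := by
  by_cases h1 : s = 1
  · rw [h1, hz_one]; exact one_ne_zero
  · rw [hz_of_ne h1]
    refine mul_ne_zero (sub_ne_zero.mpr h1) ?_
    intro h
    have := hRH s h ?_ h1
    · linarith
    · rintro ⟨n, hn⟩
      rw [hn] at hs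
      simp at hs
      have : (0:ℝ) ≤ n := Nat.cast_nonneg n
      linarith

lemma hz_lower : ∃ K : ℝ, 1 ≤ K ∧ ∀ t : ℝ, 1 ≤ K * ‖hz (2 + t * Complex.I)‖ := by
  have hsum : Summable (fun n : ℕ => 1 / (n:ℝ)^2) := Real.summable_one_div_nat_pow.mpr one_lt_two
  refine ⟨1 + ∑' n : ℕ, 1 / (n:ℝ)^2, by have h : 0 ≤ ∑' n : ℕ, 1 / (n:ℝ)^2 := tsum_nonneg (fun n : ℕ => (by positivity)); linarith, ?_⟩
  intro t
  set c : ℂ := 2 + t * Complex.I with hc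
  have hre : c.re = 2 := by simp [hc]
  have hc1 : c ≠ 1 := by intro h; rw [h] at hre; norm_num at hre
  have hmul := LSeries_one_mul_Lseries_moebius (s := c) (by rw [hre]; norm_num)
  rw [LSeries_one_eq_riemannZeta (by rw [hre]; norm_num)] at hmul
  have hL : ‖LSeries (fun n => (ArithmeticFunction.moebius n : ℂ)) c‖ ≤ ∑' n : ℕ, 1 / (n:ℝ)^2 := by
    unfold LSeries
    refine tsum_of_norm_bounded hsum.hasSum ?_
    intro n
    rcases eq_or_ne n 0 with rfl | hn
    · simp
    rw [LSeries.norm_term_eq, if_neg hn, hre]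
    rw [show ((n:ℝ)^(2:ℝ)) = (n:ℝ)^2 by norm_cast]
    gcongr
    rw [Complex.norm_intCast]
    exact_mod_cast ArithmeticFunction.abs_moebius_le_one
  rw [hz_of_ne hc1, norm_mul]
  have h1 : 1 ≤ ‖c - 1‖ := by
    have := Complex.abs_re_le_norm (c-1)
    rw [Complex.sub_re, hre] at this
    norm_num at this; exact this
  have h2 : 1 = ‖riemannZeta c‖ * ‖LSeries (fun n => (ArithmeticFunction.moebius n : ℂ)) c‖ := by
    rw [← norm_mul, hmul]; simp
  have h3 : 0 ≤ ‖riemannZeta c‖ := norm_nonneg _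
  have h4 : 0 ≤ ∑' n : ℕ, 1 / (n:ℝ)^2 := tsum_nonneg (fun n : ℕ => (by positivity))
  calc (1:ℝ) = _ := h2
    _ ≤ ‖riemannZeta c‖ * (∑' n : ℕ, 1 / (n:ℝ)^2) := by gcongr
    _ ≤ (1 + ∑' n : ℕ, 1 / (n:ℝ)^2) * (1 * ‖riemannZeta c‖) := by nlinarith
    _ ≤ _ := by gcongr

lemma bc_lower {f : ℂ → ℂ} {c : ℂ} {R M : ℝ} (hR : 0 < R) (hM : 0 < M)
    (hf : DifferentiableOn ℂ f (Metric.ball c R)) (hne : ∀ z ∈ Metric.ball c R, f z ≠ 0)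
    (hb : ∀ z ∈ Metric.ball c R, ‖f z‖ ≤ Real.exp M * ‖f c‖) {z : ℂ} (hz : z ∈ Metric.ball c R) :
    ‖f c‖ ≤ ‖f z‖ * Real.exp (2 * M * ‖z - c‖ / (R - ‖z - c‖)) := by
  have hcm : c ∈ Metric.ball c R := Metric.mem_ball_self hR
  have hlog : DifferentiableOn ℂ (fun z => deriv f z / f z) (Metric.ball c R) :=
    (hf.deriv Metric.isOpen_ball).div hf hne
  obtain ⟨g, hg⟩ := hlog.isExactOn_ball
  -- f z * exp (-(g z)) constant
  have hconst : ∀ w ∈ Metric.ball c R, f w * Complex.exp (-(g w)) = f c * Complex.exp (-(g c)) := by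
    have hd : ∀ w ∈ Metric.ball c R, HasDerivAt (fun w => f w * Complex.exp (-(g w))) 0 w := by
      intro w hw
      have h1 := (hf.differentiableAt (Metric.isOpen_ball.mem_nhds hw)).hasDerivAt
      have h2 := h1.mul ((hg w hw).neg.cexp)
      refine HasDerivAt.congr_deriv h2 ?_
      have h3 : f w * (deriv f w / f w) = deriv f w := mul_div_cancel₀ _ (hne w hw)
      linear_combination (-Complex.exp (-(g w))) * h3
    intro w hw
    refine (convex_ball c R).is_const_of_fderivWithin_eq_zero (𝕜 := ℂ) (fun x hx => (hd x hx).differentiableAt.differentiableWithinAt) ?_ hw hcm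
    intro x hx
    rw [fderivWithin_of_isOpen Metric.isOpen_ball hx]
    ext; simp [(hd x hx).deriv]
  have hfg : ∀ w ∈ Metric.ball c R, f w = f c * Complex.exp (g w - g c) := by
    intro w hw
    have := hconst w hw
    rw [sub_eq_add_neg, Complex.exp_add]
    calc f w = (f w * Complex.exp (-(g w))) * Complex.exp (g w) := by
          rw [mul_assoc, ← Complex.exp_add]; simp
      _ = _ := by rw [this]; ring
  set G : ℂ → ℂ := fun u => g (c + u) - g c with hG
  have hmem : ∀ u ∈ Metric.ball (0:ℂ) R, c + u ∈ Metric.ball c R := by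
    intro u hu; simpa [Metric.mem_ball, dist_eq_norm] using hu
  have hGd : DifferentiableOn ℂ G (Metric.ball 0 R) := by
    intro u hu
    refine DifferentiableAt.differentiableWithinAt ?_
    have h1 : DifferentiableAt ℂ g (c + u) := (hg _ (hmem u hu)).differentiableAt
    exact (h1.comp u (by fun_prop : DifferentiableAt ℂ (fun u => c + u) u)).sub_const _
  have hfc : 0 < ‖f c‖ := norm_pos_iff.mpr (hne c hcm)
  have hre : Set.MapsTo G (Metric.ball 0 R) {z | z.re ≤ M} := by
    intro u hu
    have h1 := hb _ (hmem u hu)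
    rw [hfg _ (hmem u hu), norm_mul, Complex.norm_exp, mul_comm] at h1
    have h2 := le_of_mul_le_mul_right h1 hfc
    exact Real.exp_le_exp.mp h2
  have hzu : z - c ∈ Metric.ball (0:ℂ) R := by simpa [Metric.mem_ball, dist_eq_norm] using hz
  have key := Complex.borelCaratheodory_zero hM hGd hre hR hzu (by simp [hG])
  have hGz : G (z - c) = g z - g c := by simp [hG]
  rw [hGz] at key
  rw [hfg z hz, norm_mul, Complex.norm_exp, mul_assoc, ← Real.exp_add]
  have : 0 ≤ (g z - g c).re + 2 * M * ‖z - c‖ / (R - ‖z - c‖) := by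
    have := Complex.abs_re_le_norm (g z - g c)
    have := neg_abs_le (g z - g c).re
    linarith
  have := Real.one_le_exp this
  nlinarith

/-- holomorphic version of `1/ζ` -/
noncomputable def iz (s : ℂ) : ℂ := (s - 1) / hz s

lemma iz_eq {s : ℂ} (hs : s ≠ 1) : iz s = (riemannZeta s)⁻¹ := by
  have : s - 1 ≠ 0 := sub_ne_zero.mpr hs
  rw [iz, hz_of_ne hs]; field_simp

lemma iz_diff (hRH : RiemannHypothesis) {s : ℂ} (hs : 1/2 < s.re) : DifferentiableAt ℂ iz s :=
  DifferentiableAt.div (by fun_prop) (hz_diff s) (hz_ne_zero hRH hs)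

lemma iz_bound (hRH : RiemannHypothesis) {δ : ℝ} (hδ : 0 < δ) :
    ∃ C : ℝ, ∃ A : ℕ, 0 < C ∧ ∀ s : ℂ, 1/2 + δ ≤ s.re → s.re ≤ 2 → ‖iz s‖ ≤ C * (1 + ‖s‖)^A := by
  obtain ⟨K, hK1, hK⟩ := hz_lower
  set e : ℕ := ⌈3/δ⌉₊ with he
  have hK0 : 0 < K := by linarith
  refine ⟨K * (3 * K * 16 * 4)^e, 2*e+1, by positivity, ?_⟩
  intro s hs1 hs2
  set c : ℂ := 2 + s.im * Complex.I with hc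
  have hcre : c.re = 2 := by simp [hc]
  have hcim : c.im = s.im := by simp [hc]
  have hsc : ‖s - c‖ = 2 - s.re := by
    have : s - c = ((s.re - 2 : ℝ) : ℂ) := by
      apply Complex.ext <;> simp [hc]
    rw [this, Complex.norm_real, Real.norm_eq_abs, abs_sub_comm, abs_of_nonneg (by linarith)]
  have hcn : ‖c‖ ≤ 2 + ‖s‖ := by
    calc ‖c‖ ≤ ‖(2:ℂ)‖ + ‖(s.im:ℂ) * Complex.I‖ := norm_add_le _ _
      _ ≤ 2 + ‖s‖ := by
        simp
        exact Complex.abs_im_le_norm s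
  have hballre : ∀ z ∈ Metric.ball c (3/2), 1/2 < z.re := by
    intro z hz
    rw [Metric.mem_ball, dist_eq_norm] at hz
    have := (Complex.abs_re_le_norm (z - c)).trans_lt hz
    rw [Complex.sub_re, hcre, abs_lt] at this
    linarith [this.1]
  set M : ℝ := Real.log (3 * K * (2 * (3 + ‖s‖))^2) with hM
  have hbig : 1 < 3 * K * (2 * (3 + ‖s‖))^2 := by nlinarith [norm_nonneg s]
  have hMpos : 0 < M := Real.log_pos hbig
  have hexpM : Real.exp M = 3 * K * (2 * (3 + ‖s‖))^2 := Real.exp_log (by linarith)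
  have hsmem : s ∈ Metric.ball c (3/2) := by
    rw [Metric.mem_ball, dist_eq_norm, hsc]; linarith
  have key := bc_lower (f := hz) (c := c) (R := 3/2) (M := M) (by norm_num) hMpos
    hz_diff.differentiableOn (fun z hz => hz_ne_zero hRH (hballre z hz)) ?_ hsmem
  · have hexp : Real.exp (2 * M * ‖s - c‖ / (3/2 - ‖s - c‖)) ≤ (3 * K * (2 * (3 + ‖s‖))^2)^e := by
      rw [← hexpM, ← Real.exp_nat_mul]
      apply Real.exp_le_exp.mpr
      rw [hsc, div_le_iff₀ (by linarith)]
      have h1 : 3/δ ≤ e := Nat.le_ceil _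
      have h2 : 3 ≤ e * δ := by rwa [div_le_iff₀ hδ] at h1
      have h3 : 3 ≤ e * (3/2 - (2 - s.re)) := h2.trans (by gcongr; linarith)
      nlinarith
    have hlow := hK s.im
    rw [← hc] at hlow
    have hzs : 0 < ‖hz s‖ := norm_pos_iff.mpr (hz_ne_zero hRH (by linarith))
    have h5 : 1 ≤ K * (‖hz s‖ * (3 * K * (2 * (3 + ‖s‖))^2)^e) :=
      hlow.trans (by gcongr; exact key.trans (by gcongr))
    rw [iz, norm_div, div_le_iff₀ hzs]
    have h6 : ‖s - 1‖ ≤ 1 + ‖s‖ := by simpa [add_comm] using norm_sub_le s 1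
    have h7 : 3 * K * (2 * (3 + ‖s‖))^2 ≤ (3 * K * 16 * 4) * (1 + ‖s‖)^2 := by
      have : (2 * (3 + ‖s‖))^2 ≤ 64 * (1 + ‖s‖)^2 := by nlinarith [norm_nonneg s]
      nlinarith
    have h8 : (3 * K * (2 * (3 + ‖s‖))^2)^e ≤ (3 * K * 16 * 4)^e * (1 + ‖s‖)^(2*e) := by
      rw [pow_mul, ← mul_pow]
      exact pow_le_pow_left₀ (by positivity) h7 _
    calc ‖s - 1‖ ≤ (1 + ‖s‖) * 1 := by linarith
      _ ≤ (1 + ‖s‖) * (K * (‖hz s‖ * ((3 * K * 16 * 4)^e * (1 + ‖s‖)^(2*e)))) := by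
        gcongr
        exact h5.trans (by gcongr)
      _ = _ := by ring
  · intro z hzm
    have h1 := hz_norm_le (hballre z hzm)
    rw [Metric.mem_ball, dist_eq_norm] at hzm
    have h2 : ‖z‖ ≤ ‖c‖ + 3/2 := by
      have : ‖z‖ ≤ ‖z - c‖ + ‖c‖ := by simpa using norm_add_le (z - c) c
      linarith
    rw [hexpM]
    have hlow := hK s.im
    rw [← hc] at hlow
    have h3 : 1 + ‖z‖ ≤ 2 * (3 + ‖s‖) := by linarith [norm_nonneg s]
    calc ‖hz z‖ ≤ 3 * (1 + ‖z‖)^2 * 1 := by linarith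
      _ ≤ 3 * (2 * (3 + ‖s‖))^2 * (K * ‖hz c‖) := by gcongr
      _ = _ := by ring

noncomputable def uy (y : ℝ) (d : ℤ) : ℝ := if d = 0 then 0 else 1 / (1 + |(d:ℝ)| * y)^2

lemma uy_nonneg (y : ℝ) (d : ℤ) : 0 ≤ uy y d := by unfold uy; split_ifs <;> positivity

lemma uy_nat {y : ℝ} (hy : 0 < y) : Summable (fun n : ℕ => uy y (n:ℤ)) ∧ ∑' n : ℕ, uy y (n:ℤ) ≤ 1 / y := by
  have hpart : ∀ n : ℕ, ∑ i ∈ Finset.range (n+1), uy y (i:ℤ) ≤ 1/y * (1 - 1/(1 + n*y)) := by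
    intro n
    induction n with
    | zero => simp [uy]
    | succ n ih =>
      rw [Finset.sum_range_succ]
      have h1 : uy y ((n+1:ℕ):ℤ) = 1 / (1 + (n+1)*y)^2 := by
        unfold uy
        rw [if_neg (by omega)]
        push_cast
        rw [abs_of_nonneg (by positivity)]
      rw [h1]
      have h2 : 1 / (1 + ((n:ℝ)+1)*y)^2 ≤ 1/y * (1/(1+n*y) - 1/(1+(n+1)*y)) := by
        have e : 1/y * (1/(1+n*y) - 1/(1+(n+1)*y)) = 1 / ((1+n*y) * (1+(n+1)*y)) := by
          field_simp; ring
        rw [e, sq]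
        have hn : (0:ℝ) ≤ n := Nat.cast_nonneg n
        gcongr
        linarith
      push_cast
      calc _ ≤ _ := add_le_add ih h2
        _ = _ := by ring
  have hle : ∀ n : ℕ, ∑ i ∈ Finset.range n, uy y (i:ℤ) ≤ 1/y := by
    intro n
    calc _ ≤ ∑ i ∈ Finset.range (n+1), uy y (i:ℤ) := by
          rw [Finset.sum_range_succ]; linarith [uy_nonneg y (n:ℤ)]
      _ ≤ _ := hpart n
      _ ≤ 1/y * 1 := by
          gcongr
          have : 0 ≤ 1/(1+n*y) := by positivity
          linarith
      _ = _ := by ring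
  exact ⟨summable_of_sum_range_le (fun n => uy_nonneg _ _) hle, Real.tsum_le_of_sum_range_le (fun n => uy_nonneg _ _) hle⟩

lemma uy_neg (y : ℝ) (d : ℤ) : uy y (-d) = uy y d := by unfold uy; simp

lemma uy_sum {y : ℝ} (hy : 0 < y) : Summable (uy y) ∧ ∑' d, uy y d ≤ 2 / y := by
  obtain ⟨h1, h2⟩ := uy_nat hy
  have h := HasSum.of_nat_of_neg (f := uy y) h1.hasSum (by simpa only [uy_neg] using h1.hasSum)
  refine ⟨h.summable, ?_⟩
  rw [h.tsum_eq]
  have : uy y 0 = 0 := by simp [uy]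
  rw [this]
  have e : 2 / y = 1/y + 1/y := by ring
  linarith

lemma schwartz_decay2 (v : SchwartzMap ℝ ℂ) : ∃ C : ℝ, 0 < C ∧ ∀ x, ‖v x‖ ≤ C * (1 / (1 + |x|)^2) := by
  refine ⟨2 ^ 2 * ((Finset.Iic ((2,0):ℕ × ℕ)).sup fun m => SchwartzMap.seminorm ℝ m.1 m.2) v + 1, ?_, ?_⟩
  · have : 0 ≤ ((Finset.Iic ((2,0):ℕ × ℕ)).sup fun m => SchwartzMap.seminorm (𝕜 := ℝ) (E := ℝ) (F := ℂ) m.1 m.2) v := apply_nonneg _ _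
    linarith
  · intro x
    have := SchwartzMap.one_add_le_sup_seminorm_apply (𝕜 := ℝ) (m := (2,0)) (k := 2) (n := 0) le_rfl le_rfl v x
    rw [norm_iteratedFDeriv_zero, Real.norm_eq_abs] at this
    rw [mul_one_div, le_div_iff₀ (by positivity), mul_comm]
    simp only at this ⊢
    linarith

/-- trivial bound -/
lemma schwartz_sum (v : SchwartzMap ℝ ℂ) : ∃ C : ℝ, 0 < C ∧ ∀ y : ℝ, 0 < y → ∀ d : ℤ, d ≠ 0 →
    ‖v (d * y)‖ ≤ C * uy y d := by
  obtain ⟨C, hC, h⟩ := schwartz_decay2 v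
  refine ⟨C, hC, fun y hy d hd => (h _).trans ?_⟩
  rw [uy, if_neg hd, abs_mul, abs_of_pos hy]

lemma norm_gaussSum_le {m : ℕ} [NeZero m] {χ : DirichletCharacter ℂ m} (hχ : χ.IsPrimitive) :
    ‖gaussSum χ ZMod.stdAddChar‖ ≤ Real.sqrt m := by
  set ψ : AddChar (ZMod m) ℂ := ZMod.stdAddChar with hψ
  have hψp : ψ.IsPrimitive := ZMod.isPrimitive_stdAddChar m
  set S : ℂ := ∑ k : ZMod m, χ k * star (χ k) with hS
  have hconj : ∀ x : ZMod m, star (ψ x) = ψ (-x) := by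
    intro x
    rw [AddChar.map_neg_eq_conj]; rfl
  have h1 : ∑ k : ZMod m, gaussSum χ (ψ.mulShift k) * star (gaussSum χ (ψ.mulShift k)) = m * S := by
    have : ∀ k : ZMod m, gaussSum χ (ψ.mulShift k) * star (gaussSum χ (ψ.mulShift k))
       = ∑ a, ∑ b, χ a * star (χ b) * ψ (k * (a - b)) := by
      intro k
      simp only [gaussSum, star_sum, Finset.sum_mul_sum, AddChar.mulShift_apply, star_mul', hconj]
      refine Finset.sum_congr rfl fun a _ => Finset.sum_congr rfl fun b _ => ?_
      rw [show k * (a - b) = k * a + -(k*b) by ring, AddChar.map_add_eq_mul]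
      ring
    simp_rw [this]
    rw [Finset.sum_comm]
    simp_rw [Finset.sum_comm (s := Finset.univ (α := ZMod m)) (t := Finset.univ) (f := fun k b => _ * ψ (k * (_ - b)))]
    simp_rw [← Finset.mul_sum, AddChar.sum_mulShift _ hψp]
    simp only [sub_eq_zero, ZMod.card]
    rw [hS, Finset.mul_sum]
    refine Finset.sum_congr rfl fun a _ => ?_
    rw [Finset.sum_eq_single a]
    · simp; ring
    · intro b _ hb
      rw [if_neg (Ne.symm hb)]; simp
    · simp
  have h2 : ∑ k : ZMod m, gaussSum χ (ψ.mulShift k) * star (gaussSum χ (ψ.mulShift k)) =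
     (gaussSum χ ψ * star (gaussSum χ ψ)) * S := by
    rw [hS, Finset.mul_sum]
    refine Finset.sum_congr rfl fun k _ => ?_
    rw [gaussSum_mulShift_of_isPrimitive ψ hχ, ← MulChar.star_apply', star_mul', star_star]
    ring
  have hS0 : S ≠ 0 := by
    have e : S = ((∑ k : ZMod m, ‖χ k‖^2 : ℝ) : ℂ) := by
      rw [hS]; push_cast
      refine Finset.sum_congr rfl fun k _ => ?_
      exact Complex.mul_conj' _
    rw [e]
    have : (0:ℝ) < ∑ k : ZMod m, ‖χ k‖^2 := by
      refine Finset.sum_pos' (fun _ _ => by positivity) ⟨1, Finset.mem_univ _, ?_⟩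
      simp
    exact_mod_cast this.ne'
  have h3 : gaussSum χ ψ * star (gaussSum χ ψ) = m := mul_right_cancel₀ hS0 (h2.symm.trans h1)
  have h4 : ‖gaussSum χ ψ‖^2 = m := by
    have := Complex.mul_conj' (gaussSum χ ψ)
    have h5 : ((‖gaussSum χ ψ‖^2 : ℝ) : ℂ) = (m:ℝ) := by
      push_cast; rw [← this]; exact h3
    exact_mod_cast h5
  rw [← h4, Real.sqrt_sq (norm_nonneg _)]

lemma sum_fin_zmod {m : ℕ} [NeZero m] (F : ZMod m → ℂ) : ∑ i : Fin m, F ((i:ℕ) : ZMod m) = ∑ a, F a := by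
  refine Fintype.sum_bijective (fun i : Fin m => ((i:ℕ) : ZMod m)) ?_ _ _ (fun _ => rfl)
  rw [Fintype.bijective_iff_injective_and_card]
  refine ⟨?_, by simp [ZMod.card]⟩
  intro i j h
  have := congrArg ZMod.val h
  simp only [ZMod.val_natCast, Nat.mod_eq_of_lt i.2, Nat.mod_eq_of_lt j.2] at this
  exact Fin.ext this

noncomputable def scaleS (v : SchwartzMap ℝ ℂ) (c : ℝ) (hc : c ≠ 0) : SchwartzMap ℝ ℂ :=
  SchwartzMap.compCLMOfContinuousLinearEquiv ℂ (ContinuousLinearEquiv.unitsEquivAut ℝ (Units.mk0 c hc)) v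

lemma scaleS_apply (v : SchwartzMap ℝ ℂ) (c : ℝ) (hc : c ≠ 0) (x : ℝ) : scaleS v c hc x = v (x * c) := by
  simp [scaleS]

lemma fourier_scaleS (v : SchwartzMap ℝ ℂ) (c : ℝ) (hc : 0 < c) (ξ : ℝ) :
    (FourierTransform.fourier (scaleS v c hc.ne')) ξ = (c⁻¹ : ℝ) * (FourierTransform.fourier v) (ξ * c⁻¹) := by
  rw [SchwartzMap.fourier_coe, SchwartzMap.fourier_coe, Real.fourier_real_eq, Real.fourier_real_eq]
  have := MeasureTheory.Measure.integral_comp_mul_left (fun x : ℝ => Real.fourierChar (-(x * (ξ * c⁻¹))) • v x) c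
  rw [abs_of_pos (by positivity)] at this
  rw [← Complex.real_smul, ← this]
  congr 1
  ext x
  rw [scaleS_apply]
  congr 2
  · congr 1; field_simp
  · ring

lemma char_poisson (v : SchwartzMap ℝ ℂ) : ∃ C : ℝ, 0 < C ∧ ∀ (m : ℕ) (_ : NeZero m) (χ : DirichletCharacter ℂ m),
    1 < m → χ.IsPrimitive → ∀ y : ℝ, 0 < y → ‖∑' d : ℤ, χ (d : ZMod m) * v (d * y)‖ ≤ C * Real.sqrt m := by
  obtain ⟨C', hC', hC⟩ := schwartz_sum (FourierTransform.fourier v)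
  obtain ⟨C1, hC1', hC1⟩ := schwartz_sum v
  refine ⟨2*C', by positivity, ?_⟩
  intro m _ χ hm hχ y hy
  have hm0 : (0:ℝ) < m := by exact_mod_cast (by omega : 0 < m)
  have hχ0 : ∀ χ : DirichletCharacter ℂ m, χ 0 = 0 := by
    intro χ
    have : Nontrivial (ZMod m) := ZMod.nontrivial_iff.mpr (by omega)
    exact MulChar.map_zero _
  have hsumm : Summable (fun d : ℤ => χ (d : ZMod m) * v (d * y)) := by
    refine Summable.of_norm_bounded ((uy_sum hy).1.mul_left C1) ?_
    intro d
    by_cases hd : d = 0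
    · subst hd; simp [hχ0, uy]
    · rw [norm_mul]
      calc _ ≤ 1 * ‖v (d*y)‖ := by gcongr; exact DirichletCharacter.norm_le_one _ _
        _ ≤ _ := by rw [one_mul]; exact hC1 y hy d hd
  set c : ℝ := m * y with hc
  have hcpos : 0 < c := by positivity
  set f := scaleS v c hcpos.ne' with hf
  have hFsum : Summable (fun k : ℤ => ‖(FourierTransform.fourier f) (k:ℝ)‖) := by
    have h0 : Summable (fun k : ℤ => C' * (c⁻¹ * uy c⁻¹ k) + (if k = 0 then ‖(FourierTransform.fourier f) 0‖ else 0)) := by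
      refine Summable.add (((uy_sum (inv_pos.mpr hcpos)).1.mul_left _).mul_left _) ?_
      exact (hasSum_ite_eq 0 _).summable
    refine Summable.of_nonneg_of_le (fun _ => norm_nonneg _) ?_ h0
    intro k
    by_cases hk : k = 0
    · subst hk; simp [uy]
    · rw [if_neg hk, fourier_scaleS v c hcpos, norm_mul, Complex.norm_real, Real.norm_eq_abs, abs_of_pos (by positivity)]
      have := hC c⁻¹ (by positivity) k hk
      calc c⁻¹ * _ ≤ c⁻¹ * (C' * uy c⁻¹ k) := by gcongr
        _ = _ := by ring
  -- residue classes
  have h1 : ∑' d : ℤ, χ (d : ZMod m) * v (d * y) =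
      ∑ a : Fin m, χ ((a:ℕ):ZMod m) * ∑' k : ℤ, f (((a:ℕ):ℝ)/m + k) := by
    rw [← (Int.divModEquiv m).symm.tsum_eq]
    have hs2 := ((Int.divModEquiv m).symm.summable_iff).mpr hsumm
    rw [← (Equiv.prodComm _ _).tsum_eq]
    have hs3 := ((Equiv.prodComm (Fin m) ℤ).summable_iff).mpr hs2
    refine (Summable.tsum_prod hs3).trans ?_
    rw [tsum_fintype]
    refine Finset.sum_congr rfl fun a _ => ?_
    rw [← tsum_mul_left]
    refine tsum_congr fun k => ?_
    simp only [Function.comp_apply, Equiv.prodComm_apply, Prod.swap_prod_mk, Int.divModEquiv_symm_apply]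
    rw [hf, scaleS_apply]
    congr 2
    · simp
    · push_cast; rw [hc]; field_simp
      ring
  rw [h1]
  simp_rw [SchwartzMap.tsum_eq_tsum_fourier, ← tsum_mul_left]
  have hs4 : ∀ a : Fin m, Summable (fun k : ℤ => χ ((a:ℕ):ZMod m) * ((FourierTransform.fourier f) (k:ℝ) * (fourier k) ((((a:ℕ):ℝ)/m : ℝ) : AddCircle (1:ℝ)))) := by
    intro a
    refine Summable.mul_left _ ?_
    refine Summable.of_norm_bounded hFsum ?_
    intro k
    rw [norm_mul, fourier_apply, Circle.norm_coe, mul_one]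
  rw [← Summable.tsum_finsetSum (fun a _ => hs4 a)]
  have h2 : ∀ k : ℤ, ∑ a : Fin m, χ ((a:ℕ):ZMod m) * ((FourierTransform.fourier f) (k:ℝ) * (fourier k) ((((a:ℕ):ℝ)/m : ℝ) : AddCircle (1:ℝ)))
     = (FourierTransform.fourier f) (k:ℝ) * (χ⁻¹ (k : ZMod m) * gaussSum χ ZMod.stdAddChar) := by
    intro k
    rw [← gaussSum_mulShift_of_isPrimitive _ hχ, gaussSum, ← sum_fin_zmod, Finset.mul_sum]
    refine Finset.sum_congr rfl fun a _ => ?_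
    rw [AddChar.mulShift_apply]
    have : (k : ZMod m) * (((a:ℕ)):ZMod m) = ((k * (a:ℕ) : ℤ) : ZMod m) := by push_cast; rfl
    rw [this, ZMod.stdAddChar_coe, fourier_coe_apply]
    have e : Complex.exp (2 * Real.pi * Complex.I * k * ((((a:ℕ):ℝ)/m : ℝ):ℂ) / (1:ℝ)) = Complex.exp (2 * Real.pi * Complex.I * ((k * (a:ℕ) : ℤ):ℂ) / m) := by
      congr 1; push_cast; ring
    rw [e]; ring
  simp_rw [h2]
  have hb : ∀ k : ℤ, ‖(FourierTransform.fourier f) (k:ℝ) * (χ⁻¹ (k : ZMod m) * gaussSum χ ZMod.stdAddChar)‖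
     ≤ (C' * c⁻¹ * Real.sqrt m) * uy c⁻¹ k := by
    intro k
    by_cases hk : k = 0
    · subst hk; simp [hχ0, uy]
    · rw [norm_mul, norm_mul, fourier_scaleS v c hcpos, norm_mul, Complex.norm_real, Real.norm_eq_abs, abs_of_pos (by positivity)]
      have h3 := hC c⁻¹ (by positivity) k hk
      calc _ ≤ c⁻¹ * (C' * uy c⁻¹ k) * (1 * Real.sqrt m) := by
            have := uy_nonneg c⁻¹ k
            gcongr
            · exact DirichletCharacter.norm_le_one _ _
            · exact norm_gaussSum_le hχ
        _ = _ := by ring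
  obtain ⟨hu1, hu2⟩ := uy_sum (inv_pos.mpr hcpos)
  refine (tsum_of_norm_bounded (hu1.mul_left _).hasSum hb).trans ?_
  rw [tsum_mul_left]
  calc _ ≤ (C' * c⁻¹ * Real.sqrt m) * (2 / c⁻¹) := by gcongr
    _ = _ := by field_simp

lemma aux_div1 {ε : ℝ} (hε : 0 < ε) : ∃ K : ℝ, 1 ≤ K ∧ ∀ (p a : ℕ), 2 ≤ p → (a + 1 : ℝ) ≤ K * ((p:ℝ)^a)^ε := by
  refine ⟨1 + 1/(ε * Real.log 2), ?_, ?_⟩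
  · have := Real.log_pos (by norm_num : (1:ℝ) < 2)
    have : 0 < 1/(ε * Real.log 2) := by positivity
    linarith
  intro p a hp
  have hl := Real.log_pos (by norm_num : (1:ℝ) < 2)
  have hp' : (2:ℝ) ≤ p := by exact_mod_cast hp
  have h1 : (2:ℝ)^(a*ε) ≤ ((p:ℝ)^a)^ε := by
    rw [← Real.rpow_natCast, ← Real.rpow_mul (by positivity)]
    exact Real.rpow_le_rpow (by norm_num) hp' (by positivity)
  have h2 : 1 + a*ε*Real.log 2 ≤ (2:ℝ)^(a*ε) := by
    rw [Real.rpow_def_of_pos (by norm_num)]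
    have := Real.add_one_le_exp (Real.log 2 * (a*ε))
    linarith
  calc (a+1:ℝ) ≤ (1 + 1/(ε * Real.log 2)) * (1 + a*ε*Real.log 2) := by
        have : (1 + 1/(ε * Real.log 2)) * (1 + a*ε*Real.log 2) = 1 + a + 1/(ε * Real.log 2) + a*ε*Real.log 2 := by
          field_simp; ring
        rw [this]
        have h3 : 0 < 1/(ε * Real.log 2) := by positivity
        have h4 : 0 ≤ a*ε*Real.log 2 := by positivity
        linarith
    _ ≤ _ := by gcongr; linarith

lemma divisor_bound {ε : ℝ} (hε : 0 < ε) : ∃ C : ℝ, 0 < C ∧ ∀ k : ℕ, 0 < k → ((k.divisors.card : ℕ) : ℝ) ≤ C * (k:ℝ)^ε := by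
  obtain ⟨K, hK1, hK⟩ := aux_div1 hε
  set M : ℕ := ⌈(2:ℝ)^(1/ε)⌉₊ with hM
  refine ⟨K^M, by positivity, ?_⟩
  intro k hk
  rw [Nat.card_divisors hk.ne']
  have h1 : (k:ℝ)^ε = ∏ p ∈ k.primeFactors, ((p:ℝ)^(k.factorization p))^ε := by
    conv_lhs => rw [← Nat.prod_factorization_pow_eq_self hk.ne']
    rw [Finsupp.prod, Nat.support_factorization, Nat.cast_prod, ← Real.finsetProd_rpow _ _ (fun i _ => by positivity)]
    push_cast
    rfl
  rw [h1]
  push_cast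
  have h2 : ∀ p ∈ k.primeFactors, ((k.factorization p : ℝ) + 1) ≤ (if p < M then K else 1) * ((p:ℝ)^(k.factorization p))^ε := by
    intro p hp
    have hp2 := (Nat.prime_of_mem_primeFactors hp).two_le
    split_ifs with h
    · exact hK p _ hp2
    · rw [one_mul]
      have h3 : (2:ℝ)^(1/ε) ≤ p := (Nat.le_ceil _).trans (by exact_mod_cast not_lt.mp h)
      have h4 : (2:ℝ) ≤ (p:ℝ)^ε := by
        have := Real.rpow_le_rpow (by positivity) h3 hε.le
        rwa [← Real.rpow_mul (by norm_num), one_div_mul_cancel hε.ne', Real.rpow_one] at this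
      have h5 : ((p:ℝ)^(k.factorization p))^ε = ((p:ℝ)^ε)^(k.factorization p) := by
        rw [← Real.rpow_natCast, ← Real.rpow_natCast, ← Real.rpow_mul (by positivity), ← Real.rpow_mul (by positivity), mul_comm]
      rw [h5]
      calc ((k.factorization p : ℝ) + 1) ≤ 2^(k.factorization p) := by
            exact_mod_cast (Nat.lt_two_pow_self (n := k.factorization p))
        _ ≤ _ := by gcongr
  refine (Finset.prod_le_prod (fun i _ => by positivity) h2).trans ?_
  rw [Finset.prod_mul_distrib]
  gcongr
  rw [Finset.prod_ite, Finset.prod_const, Finset.prod_const_one, mul_one]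
  refine pow_le_pow_right₀ hK1 ?_
  calc _ ≤ (Finset.range M).card := Finset.card_le_card (by intro x hx; simpa using (Finset.mem_filter.mp hx).2)
    _ = M := Finset.card_range M

lemma jacobi_neg_one {n : ℕ} (hodd : Odd n) (hn : 0 < n) (hsq : ¬ IsSquare n) : ∃ b : ℤ, jacobiSym b n = -1 := by
  obtain ⟨a, b, hab, ha⟩ := Nat.sq_mul_squarefree n
  have hb1 : a ≠ 1 := by
    rintro rfl
    exact hsq ⟨b, by rw [← hab]; ring⟩
  have hb0 : b ≠ 0 := by rintro rfl; simp at hab; omega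
  obtain ⟨p, hp, c, rfl⟩ := Nat.exists_prime_and_dvd hb1
  have hcop : p.Coprime c := Nat.coprime_of_squarefree_mul ha
  have hpo : Odd p := by
    rw [← hab] at hodd
    exact (Nat.odd_mul.mp (Nat.odd_mul.mp hodd).2).1
  have hp2 : p ≠ 2 := by rintro rfl; revert hpo; decide
  have : Fact p.Prime := ⟨hp⟩
  obtain ⟨r, hr⟩ := FiniteField.exists_nonsquare (F := ZMod p) (by rw [ZMod.ringChar_zmod_n]; exact hp2)
  have hr0 : r ≠ 0 := by rintro rfl; exact hr ⟨0, by simp⟩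
  obtain ⟨k, b0, hb0p, hbk⟩ := Nat.exists_eq_pow_mul_and_not_dvd hb0 p hp.ne_one
  have hcop2 : p.Coprime (b0 * c) := Nat.Coprime.mul_right ((Nat.Prime.coprime_iff_not_dvd hp).mpr hb0p) hcop
  obtain ⟨B, hB1, hB2⟩ := Nat.chineseRemainder hcop2 r.val 1
  have hBr : ((B:ℤ) : ZMod p) = r := by
    have := (ZMod.natCast_eq_natCast_iff _ _ _).mpr hB1
    rw [ZMod.natCast_zmod_val] at this
    exact_mod_cast this
  have hBp : jacobiSym B p = -1 := by
    rw [ZMod.nonsquare_iff_jacobiSym_eq_neg_one, hBr]; exact hr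
  have hc0 : c ≠ 0 := by rintro rfl; simp at hab; omega
  have hBc : jacobiSym B c = 1 := by
    have h : B ≡ 1 [MOD c] := hB2.of_dvd (Dvd.intro_left _ rfl)
    rw [jacobiSym.mod_left' (a₂ := 1) (by exact_mod_cast congrArg (Nat.cast : ℕ → ℤ) (show B % c = 1 % c from h)), jacobiSym.one_left]
  have hBb : Int.gcd B b = 1 := by
    have h : B ≡ 1 [MOD b0] := hB2.of_dvd (Dvd.intro _ rfl)
    have h1 : B.Coprime b0 := by
      have := h.gcd_eq
      rw [Nat.gcd_one_left] at this
      exact this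
    have h2 : B.Coprime p := by
      rw [Nat.coprime_comm, Nat.Prime.coprime_iff_not_dvd hp]
      intro hd
      apply hr0
      rw [← hBr]
      exact_mod_cast (ZMod.natCast_eq_zero_iff _ _).mpr hd
    rw [hbk, Int.gcd_natCast_natCast]
    exact Nat.Coprime.mul_right (h2.pow_right k) h1
  refine ⟨B, ?_⟩
  rw [← hab, jacobiSym.mul_right' _ (by positivity) (mul_ne_zero hp.ne_zero hc0), jacobiSym.mul_right' _ hp.ne_zero hc0,
    jacobiSym.pow_right, jacobiSym.sq_one hBb, hBp, hBc]
  norm_num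

noncomputable def jchar (n : ℕ) [NeZero n] : DirichletCharacter ℂ n where
  toFun a := ((jacobiSym (a.val : ℤ) n : ℤ) : ℂ)
  map_one' := by
    rcases eq_or_ne n 1 with rfl | h
    · simp [jacobiSym.one_right]
    · have : Fact (1 < n) := ⟨by have := NeZero.ne n; omega⟩
      rw [ZMod.val_one]; simp
  map_mul' a b := by
    rw [ZMod.val_mul, ← Int.cast_mul, ← jacobiSym.mul_left]
    push_cast
    rw [← jacobiSym.mod_left]
  map_nonunit' a ha := by
    have : jacobiSym (a.val : ℤ) n = 0 := by
      rw [jacobiSym.eq_zero_iff_not_coprime]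
      intro h
      apply ha
      rw [Int.gcd_natCast_natCast] at h
      have := (ZMod.isUnit_iff_coprime a.val n).mpr h
      rwa [ZMod.natCast_zmod_val] at this
    rw [this]; simp

lemma jchar_int (n : ℕ) [NeZero n] (d : ℤ) : jchar n (d : ZMod n) = ((jacobiSym d n : ℤ) : ℂ) := by
  change ((jacobiSym (((d : ZMod n)).val : ℤ) n : ℤ) : ℂ) = _
  rw [ZMod.val_intCast, ← jacobiSym.mod_left]

lemma jchar_ne_one {n : ℕ} [NeZero n] (hodd : Odd n) (hsq : ¬ IsSquare n) : jchar n ≠ 1 := by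
  intro h
  obtain ⟨b, hb⟩ := jacobi_neg_one hodd (Nat.pos_of_ne_zero (NeZero.ne n)) hsq
  have h1 := jchar_int n b
  rw [h, hb] at h1
  have hu : IsUnit (b : ZMod n) := by
    by_contra hu
    rw [MulChar.map_nonunit _ hu] at h1
    norm_num at h1
  rw [MulChar.one_apply hu] at h1
  norm_num at h1

noncomputable def psi (n N : ℕ) (e : ℤ) : ℂ := if Int.gcd e N = 1 then ((jacobiSym e n : ℤ) : ℂ) else 0

noncomputable def Phi (n N : ℕ) (v : SchwartzMap ℝ ℂ) (y : ℝ) : ℂ := ∑' e : ℤ, psi n N e * v (e * y)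

lemma psi_zero {n : ℕ} (hn : 1 < n) (N : ℕ) : psi n N 0 = 0 := by
  unfold psi; rw [jacobiSym.zero_left hn]; simp

lemma norm_psi_le (n N : ℕ) (e : ℤ) : ‖psi n N e‖ ≤ 1 := by
  unfold psi
  split_ifs
  · rcases jacobiSym.trichotomy e n with h | h | h <;> rw [h] <;> simp
  · simp

lemma sum_moebius_eq (k : ℕ) : ∑ g ∈ k.divisors, ((ArithmeticFunction.moebius g : ℤ) : ℂ) = if k = 1 then 1 else 0 := by
  rw [← Int.cast_sum, ← ArithmeticFunction.coe_mul_zeta_apply, ArithmeticFunction.moebius_mul_coe_zeta, ArithmeticFunction.one_apply]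
  split_ifs <;> simp

lemma psi_eq {n N : ℕ} [NeZero n] (hN : 0 < N) (e : ℤ) :
    psi n N e = ∑ g ∈ (n*N).divisors, if (g:ℤ) ∣ e then ((ArithmeticFunction.moebius g : ℤ) : ℂ) * (jchar n).primitiveCharacter (e : ZMod _) else 0 := by
  have hn0 := NeZero.ne n
  have hq : n * N ≠ 0 := by positivity
  rw [← Finset.sum_filter, ← Finset.sum_mul]
  have h1 : (n*N).divisors.filter (fun g : ℕ => (g:ℤ) ∣ e) = (Nat.gcd e.natAbs (n*N)).divisors := by
    ext g
    simp only [Finset.mem_filter, Nat.mem_divisors, Nat.dvd_gcd_iff, Int.natCast_dvd]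
    constructor
    · rintro ⟨⟨a, b⟩, c⟩; exact ⟨⟨c, a⟩, (Nat.gcd_pos_of_pos_right _ (by omega)).ne'⟩
    · rintro ⟨⟨a, b⟩, c⟩; exact ⟨⟨b, hq⟩, a⟩
  rw [h1, sum_moebius_eq]
  unfold psi
  split_ifs with h2 h3 h3
  · have hc : IsCoprime e (n:ℤ) := by
      rw [Int.isCoprime_iff_gcd_eq_one, Int.gcd_def, Int.natAbs_natCast]
      exact Nat.Coprime.coprime_mul_right_right h3
    rw [one_mul, DirichletCharacter.primitiveCharacter_apply_of_isCoprime _ hc, jchar_int]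
  · rw [zero_mul]
    have : jacobiSym e n = 0 := by
      rw [jacobiSym.eq_zero_iff_not_coprime]
      intro h4
      apply h3
      rw [Int.gcd_def, Int.natAbs_natCast] at h4 h2
      exact Nat.Coprime.mul_right h4 h2
    rw [this]; simp
  · exfalso; apply h2
    rw [Int.gcd_def, Int.natAbs_natCast]
    exact Nat.Coprime.coprime_mul_left_right h3
  · simp

lemma summable_bdd (f : ℤ → ℂ) (hf0 : f 0 = 0) (hf : ∀ e, ‖f e‖ ≤ 1) (v : SchwartzMap ℝ ℂ) {y : ℝ} (hy : 0 < y) :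
    Summable (fun e : ℤ => f e * v (e * y)) := by
  obtain ⟨C1, hC1', hC1⟩ := schwartz_sum v
  refine Summable.of_norm_bounded ((uy_sum hy).1.mul_left C1) ?_
  intro d
  by_cases hd : d = 0
  · subst hd; simp [hf0, uy]
  · rw [norm_mul]
    calc _ ≤ 1 * ‖v (d*y)‖ := by gcongr; exact hf d
      _ ≤ _ := by rw [one_mul]; exact hC1 y hy d hd

lemma Phi_summable {n : ℕ} (hn : 1 < n) (N : ℕ) (v : SchwartzMap ℝ ℂ) {y : ℝ} (hy : 0 < y) :
    Summable (fun e : ℤ => psi n N e * v (e * y)) :=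
  summable_bdd _ (psi_zero hn N) (norm_psi_le n N) v hy

lemma Phi_bound1 (v : SchwartzMap ℝ ℂ) : ∃ C : ℝ, 0 < C ∧ ∀ n N : ℕ, 1 < n → ∀ y : ℝ, 0 < y → ‖Phi n N v y‖ ≤ C * (1/y) := by
  obtain ⟨C1, hC1', hC1⟩ := schwartz_sum v
  refine ⟨2*C1, by positivity, ?_⟩
  intro n N hn y hy
  have hb : ∀ d : ℤ, ‖psi n N d * v (d*y)‖ ≤ C1 * uy y d := by
    intro d
    by_cases hd : d = 0
    · subst hd; simp [psi_zero hn, uy]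
    · rw [norm_mul]
      calc _ ≤ 1 * ‖v (d*y)‖ := by gcongr; exact norm_psi_le n N d
        _ ≤ _ := by rw [one_mul]; exact hC1 y hy d hd
  obtain ⟨hu1, hu2⟩ := uy_sum hy
  refine (tsum_of_norm_bounded (hu1.mul_left _).hasSum hb).trans ?_
  rw [tsum_mul_left]
  calc _ ≤ C1 * (2 / y) := by gcongr
    _ = _ := by ring

lemma tsum_dvd (F : ℤ → ℂ) {g : ℕ} (hg : 0 < g) : ∑' e : ℤ, (if (g:ℤ) ∣ e then F e else 0) = ∑' d : ℤ, F (g * d) := by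
  have hinj : Function.Injective (fun d : ℤ => (g:ℤ) * d) := by
    intro a b h
    exact mul_left_cancel₀ (by exact_mod_cast hg.ne') h
  have := hinj.tsum_eq (f := fun e : ℤ => if (g:ℤ) ∣ e then F e else 0) (by
    intro e he
    simp only [Function.mem_support, ne_eq, ite_eq_right_iff, not_forall] at he
    obtain ⟨⟨d, hd⟩, _⟩ := he
    exact ⟨d, hd.symm⟩)
  rw [← this]
  refine tsum_congr fun d => ?_
  simp

lemma Phi_bound2 (v : SchwartzMap ℝ ℂ) : ∃ C : ℝ, 0 < C ∧ ∀ n N : ℕ, 1 < n → Odd n → ¬ IsSquare n → 0 < N →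
    ∀ y : ℝ, 0 < y → ‖Phi n N v y‖ ≤ C * (Real.sqrt n * (n*N).divisors.card) := by
  obtain ⟨C, hC0, hC⟩ := char_poisson v
  refine ⟨C, hC0, ?_⟩
  intro n N hn hodd hsq hN y hy
  have : NeZero n := ⟨by omega⟩
  set χ := (jchar n).primitiveCharacter with hχ
  have hc : (jchar n).conductor ≠ 0 := DirichletCharacter.conductor_ne_zero _
  have : NeZero (jchar n).conductor := ⟨hc⟩
  have hc1 : (jchar n).conductor ≠ 1 := by
    rw [Ne, ← DirichletCharacter.eq_one_iff_conductor_eq_one]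
    exact jchar_ne_one hodd hsq
  have hχ0 : χ ((0:ℤ) : ZMod _) = 0 := by
    have : Nontrivial (ZMod (jchar n).conductor) := ZMod.nontrivial_iff.mpr hc1
    rw [Int.cast_zero]
    exact MulChar.map_zero _
  have hle : (jchar n).conductor ≤ n := Nat.le_of_dvd (by omega) (DirichletCharacter.conductor_dvd_level _)
  have e1 : Phi n N v y = ∑ g ∈ (n*N).divisors, ∑' e : ℤ, if (g:ℤ) ∣ e then ((ArithmeticFunction.moebius g : ℤ) : ℂ) * χ (e : ZMod _) * v (e*y) else 0 := by
    rw [← Summable.tsum_finsetSum]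
    · unfold Phi
      refine tsum_congr fun e => ?_
      rw [psi_eq hN, Finset.sum_mul]
      refine Finset.sum_congr rfl fun g _ => ?_
      rw [ite_mul, zero_mul]
    · intro g _
      have := summable_bdd (fun e : ℤ => if (g:ℤ) ∣ e then ((ArithmeticFunction.moebius g : ℤ) : ℂ) * χ (e : ZMod _) else 0)
        (by simp only [hχ0, mul_zero, ite_self]) (by
          intro e
          split_ifs
          · rw [norm_mul]
            refine mul_le_one₀ ?_ (norm_nonneg _) (DirichletCharacter.norm_le_one _ _)
            rw [Complex.norm_intCast]
            exact_mod_cast ArithmeticFunction.abs_moebius_le_one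
          · simp) v hy
      simpa only [ite_mul, zero_mul] using this
  rw [e1]
  refine (norm_sum_le _ _).trans ?_
  have hb : ∀ g ∈ (n*N).divisors, ‖∑' e : ℤ, if (g:ℤ) ∣ e then ((ArithmeticFunction.moebius g : ℤ) : ℂ) * χ (e : ZMod _) * v (e*y) else 0‖ ≤ C * Real.sqrt n := by
    intro g hg
    have hg0 : 0 < g := Nat.pos_of_mem_divisors hg
    have hg0' : (0:ℝ) < g := by exact_mod_cast hg0
    rw [tsum_dvd (fun e : ℤ => ((ArithmeticFunction.moebius g : ℤ) : ℂ) * χ (e : ZMod _) * v (e*y)) hg0]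
    have e2 : ∀ d : ℤ, ((ArithmeticFunction.moebius g : ℤ) : ℂ) * χ (((g:ℤ) * d : ℤ) : ZMod _) * v (((g:ℤ) * d : ℤ) *y)
      = (((ArithmeticFunction.moebius g : ℤ) : ℂ) * χ ((g:ℤ) : ZMod _)) * (χ (d : ZMod _) * v (d * (g*y))) := by
      intro d
      push_cast
      rw [map_mul, show (g:ℝ) * d * y = d * (g*y) by ring]
      ring
    simp_rw [e2]
    rw [tsum_mul_left, norm_mul]
    have h3 : ‖((ArithmeticFunction.moebius g : ℤ) : ℂ) * χ ((g:ℤ) : ZMod _)‖ ≤ 1 := by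
      rw [norm_mul]
      refine mul_le_one₀ ?_ (norm_nonneg _) (DirichletCharacter.norm_le_one _ _)
      rw [Complex.norm_intCast]
      exact_mod_cast ArithmeticFunction.abs_moebius_le_one
    have h4 := hC _ inferInstance χ (by omega) (DirichletCharacter.primitiveCharacter_isPrimitive _) (g*y) (by positivity)
    calc _ ≤ 1 * (C * Real.sqrt (jchar n).conductor) := by gcongr
      _ ≤ _ := by rw [one_mul]; gcongr
  refine (Finset.sum_le_card_nsmul _ _ _ hb).trans ?_
  rw [nsmul_eq_mul]
  apply le_of_eq; ring

def PP (n N : ℕ) : Prop := 1 < n ∧ Odd n ∧ ¬ IsSquare n ∧ 0 < N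

noncomputable def BB (n N : ℕ) : ℝ := Real.sqrt n * (n*N).divisors.card

lemma BB_pos {n N : ℕ} (h : PP n N) : 0 < BB n N := by
  obtain ⟨h1, _, _, h4⟩ := h
  unfold BB
  have : 0 < (n*N).divisors.card := Finset.card_pos.mpr ⟨1, Nat.one_mem_divisors.mpr (by positivity)⟩
  positivity

noncomputable def TT (v : SchwartzMap ℝ ℂ) : SchwartzMap ℝ ℂ :=
  SchwartzMap.smulLeftCLM ℂ (fun x : ℝ => x) (SchwartzMap.derivCLM ℂ ℂ v)

lemma TT_apply (v : SchwartzMap ℝ ℂ) (x : ℝ) : TT v x = x * deriv v x := by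
  unfold TT
  rw [SchwartzMap.smulLeftCLM_apply_apply (by fun_prop), SchwartzMap.derivCLM_apply]
  simp

lemma uy_anti {y z : ℝ} (hy : 0 < y) (h : y ≤ z) (d : ℤ) : uy z d ≤ uy y d := by
  unfold uy
  split_ifs
  · exact le_rfl
  · gcongr

lemma Phi_hasDerivAt {n : ℕ} (hn : 1 < n) (N : ℕ) (v : SchwartzMap ℝ ℂ) {y : ℝ} (hy : 0 < y) :
    HasDerivAt (Phi n N v) ((y⁻¹ : ℝ) * Phi n N (TT v) y) y := by
  obtain ⟨C, hC0, hC⟩ := schwartz_sum (TT v)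
  have hy2 : 0 < y/2 := by positivity
  have key := hasDerivAt_tsum_of_isPreconnected (t := Set.Ioi (y/2)) (y := y) (y₀ := y)
    (g := fun (e : ℤ) (z : ℝ) => psi n N e * v (e * z))
    (g' := fun (e : ℤ) (z : ℝ) => psi n N e * (((z⁻¹ : ℝ):ℂ) * TT v (e * z)))
    (u := fun e : ℤ => (y/2)⁻¹ * (C * uy (y/2) e))
    (((uy_sum hy2).1.mul_left C).mul_left _) isOpen_Ioi isPreconnected_Ioi ?_ ?_ ?_ (Phi_summable hn N v hy) ?_
  · have e : (((y⁻¹ : ℝ):ℂ)) * Phi n N (TT v) y = ∑' e : ℤ, psi n N e * (((y⁻¹ : ℝ):ℂ) * TT v (e * y)) := by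
      unfold Phi
      rw [← tsum_mul_left]
      refine tsum_congr fun e => by ring
    rw [e]
    exact key
  · intro e z hz
    have hz0 : 0 < z := hy2.trans hz
    refine HasDerivAt.const_mul _ ?_
    have h1 : HasDerivAt v (deriv v (e*z)) (e*z) := (v.differentiableAt).hasDerivAt
    have h2 : HasDerivAt (fun z : ℝ => (e:ℝ) * z) (e:ℝ) z := by
      simpa using (hasDerivAt_id z).const_mul (e:ℝ)
    have h3 := h1.scomp z h2
    convert! h3 using 1
    rw [TT_apply, Complex.real_smul]
    push_cast
    have : (z:ℂ) ≠ 0 := by exact_mod_cast hz0.ne'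
    field_simp
  · intro e z hz
    have hz0 : 0 < z := hy2.trans hz
    rw [norm_mul, norm_mul, Complex.norm_real, Real.norm_eq_abs, abs_of_pos (by positivity)]
    by_cases he : e = 0
    · subst he; rw [psi_zero hn]; simp [uy]
    · have h1 := norm_psi_le n N e
      have h2 := (hC z hz0 e he).trans (mul_le_mul_of_nonneg_left (uy_anti hy2 hz.le e) hC0.le)
      have h3 : z⁻¹ ≤ (y/2)⁻¹ := inv_anti₀ hy2 hz.le
      calc _ ≤ 1 * ((y/2)⁻¹ * (C * uy (y/2) e)) := by gcongr
        _ = _ := one_mul _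
  · simp; linarith
  · simp; linarith

lemma Phi_contOn {n : ℕ} (hn : 1 < n) (N : ℕ) (v : SchwartzMap ℝ ℂ) : ContinuousOn (Phi n N v) (Set.Ioi 0) :=
  fun _ hy => (Phi_hasDerivAt hn N v hy).continuousAt.continuousWithinAt

lemma Phi_locInt {n : ℕ} (hn : 1 < n) (N : ℕ) (v : SchwartzMap ℝ ℂ) :
    MeasureTheory.LocallyIntegrableOn (Phi n N v) (Set.Ioi 0) :=
  (Phi_contOn hn N v).locallyIntegrableOn measurableSet_Ioi

lemma Phi_top {n : ℕ} (hn : 1 < n) (N : ℕ) (v : SchwartzMap ℝ ℂ) :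
    (Phi n N v) =O[Filter.atTop] (fun y : ℝ => y ^ (-1:ℝ)) := by
  obtain ⟨C, hC0, hC⟩ := Phi_bound1 v
  refine Asymptotics.IsBigO.of_bound C ?_
  filter_upwards [Filter.eventually_gt_atTop 0] with y hy
  rw [Real.rpow_neg_one, Real.norm_eq_abs, abs_of_pos (by positivity), ← one_div]
  exact hC n N hn y hy

lemma Phi_bot {n N : ℕ} (h : PP n N) (v : SchwartzMap ℝ ℂ) :
    (Phi n N v) =O[nhdsWithin 0 (Set.Ioi 0)] (fun y : ℝ => y ^ (-(0:ℝ))) := by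
  obtain ⟨C, hC0, hC⟩ := Phi_bound2 v
  refine Asymptotics.IsBigO.of_bound (C * BB n N) ?_
  filter_upwards [self_mem_nhdsWithin] with y hy
  simp only [neg_zero, Real.rpow_zero, norm_one, mul_one]
  exact hC n N h.1 h.2.1 h.2.2.1 h.2.2.2 y hy

lemma Phi_mellinConv {n N : ℕ} (h : PP n N) (v : SchwartzMap ℝ ℂ) {s : ℂ} (h0 : 0 < s.re) (h1 : s.re < 1) :
    MellinConvergent (Phi n N v) s :=
  mellinConvergent_of_isBigO_rpow (Phi_locInt h.1 N v) (Phi_top h.1 N v) h1 (Phi_bot h v) h0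

lemma Phi_mellinDiff {n N : ℕ} (h : PP n N) (v : SchwartzMap ℝ ℂ) {s : ℂ} (h0 : 0 < s.re) (h1 : s.re < 1) :
    DifferentiableAt ℂ (mellin (Phi n N v)) s :=
  mellin_differentiableAt_of_isBigO_rpow (Phi_locInt h.1 N v) (Phi_top h.1 N v) h1 (Phi_bot h v) h0

lemma Phi_mellin_TT {n N : ℕ} (h : PP n N) (v : SchwartzMap ℝ ℂ) {s : ℂ} (h0 : 0 < s.re) (h1 : s.re < 1) :
    mellin (Phi n N (TT v)) s = - s * mellin (Phi n N v) s := by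
  have hs : s ≠ 0 := by rintro rfl; simp at h0
  have hder : ∀ y ∈ Set.Ioi (0:ℝ), HasDerivAt (fun y : ℝ => (y:ℂ)^s * Phi n N v y)
      (s * ((y:ℂ)^(s-1) • Phi n N v y) + (y:ℂ)^(s-1) • Phi n N (TT v) y) y := by
    intro y hy
    have hy0 : (y:ℂ) ≠ 0 := by exact_mod_cast (ne_of_gt hy)
    have := (hasDerivAt_ofReal_cpow_const (ne_of_gt hy) hs).mul (Phi_hasDerivAt h.1 N v hy)
    convert! this using 1
    rw [Complex.cpow_sub _ _ hy0, Complex.cpow_one, smul_eq_mul, smul_eq_mul]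
    push_cast
    field_simp
  have i1 := (Phi_mellinConv h v h0 h1)
  have i2 := (Phi_mellinConv h (TT v) h0 h1)
  unfold MellinConvergent at i1 i2
  have hnorm : ∀ y : ℝ, 0 < y → ‖(y:ℂ)^s * Phi n N v y‖ = y^s.re * ‖Phi n N v y‖ := by
    intro y hy
    rw [norm_mul, Complex.norm_cpow_eq_rpow_re_of_pos hy]
  have key := MeasureTheory.integral_Ioi_of_hasDerivAt_of_tendsto (a := (0:ℝ)) (m := (0:ℂ)) (f := fun y : ℝ => (y:ℂ)^s * Phi n N v y) ?_ hder
    ((i1.const_mul s).add i2) ?_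
  · rw [MeasureTheory.integral_add (i1.const_mul s) i2, MeasureTheory.integral_const_mul] at key
    simp only [Complex.ofReal_zero, Complex.zero_cpow hs, zero_mul, sub_zero] at key
    unfold mellin
    linear_combination key
  · obtain ⟨C, hC0, hC⟩ := Phi_bound2 v
    have : Filter.Tendsto (fun y : ℝ => y^s.re * (C * BB n N)) (nhdsWithin 0 (Set.Ici 0)) (nhds 0) := by
      have h3 : ContinuousAt (fun y : ℝ => y^s.re * (C * BB n N)) 0 :=
        (Real.continuousAt_rpow_const 0 _ (Or.inr h0.le)).mul continuousAt_const
      have h4 := h3.tendsto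
      simp only [Real.zero_rpow h0.ne', zero_mul] at h4
      exact h4.mono_left nhdsWithin_le_nhds
    unfold ContinuousWithinAt
    simp only [Complex.ofReal_zero, Complex.zero_cpow hs, zero_mul]
    refine squeeze_zero_norm' ?_ this
    filter_upwards [self_mem_nhdsWithin] with y hy
    rcases (Set.mem_Ici.mp hy).eq_or_lt with rfl | hy
    · simp [Complex.zero_cpow hs, Real.zero_rpow h0.ne']
    · rw [hnorm y hy]
      gcongr
      exact hC n N h.1 h.2.1 h.2.2.1 h.2.2.2 y hy
  · obtain ⟨C, hC0, hC⟩ := Phi_bound1 v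
    have : Filter.Tendsto (fun y : ℝ => C * y^(-(1-s.re))) Filter.atTop (nhds 0) := by
      simpa using (tendsto_rpow_neg_atTop (by linarith : 0 < 1 - s.re)).const_mul C
    refine squeeze_zero_norm' ?_ this
    filter_upwards [Filter.eventually_gt_atTop 0] with y hy
    rw [hnorm y hy]
    calc _ ≤ y^s.re * (C * (1/y)) := by gcongr; exact hC n N h.1 y hy
      _ = _ := by
        rw [show -(1 - s.re) = s.re - 1 by ring, Real.rpow_sub hy, Real.rpow_one]; ring

lemma min_int {B : ℝ} (hB : 0 < B) {σ : ℝ} (h0 : 0 < σ) (h1 : σ < 1) :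
    MeasureTheory.IntegrableOn (fun y : ℝ => y^(σ-1) * min B (1/y)) (Set.Ioi 0) ∧
    ∫ y in Set.Ioi (0:ℝ), y^(σ-1) * min B (1/y) ≤ (1/σ + 1/(1-σ)) * B^(1-σ) := by
  have hBi : 0 < B⁻¹ := by positivity
  have hu : Set.Ioi (0:ℝ) = Set.Ioc 0 B⁻¹ ∪ Set.Ioi B⁻¹ := (Set.Ioc_union_Ioi_eq_Ioi hBi.le).symm
  have a1 : MeasureTheory.IntegrableOn (fun y : ℝ => y^(σ-1) * B) (Set.Ioc 0 B⁻¹) := by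
    have := (intervalIntegral.intervalIntegrable_rpow' (a := 0) (b := B⁻¹) (r := σ-1) (by linarith))
    exact ((intervalIntegrable_iff_integrableOn_Ioc_of_le hBi.le).mp this).mul_const B
  have a2 : MeasureTheory.IntegrableOn (fun y : ℝ => y^(σ-2)) (Set.Ioi B⁻¹) :=
    integrableOn_Ioi_rpow_of_lt (by linarith) hBi
  have e1 : ∀ y ∈ Set.Ioc (0:ℝ) B⁻¹, y^(σ-1) * min B (1/y) = y^(σ-1) * B := by
    intro y hy
    rw [min_eq_left]
    rw [le_div_iff₀ hy.1]
    calc B * y ≤ B * B⁻¹ := by gcongr; exact hy.2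
      _ = 1 := mul_inv_cancel₀ hB.ne'
  have e2 : ∀ y ∈ Set.Ioi B⁻¹, y^(σ-1) * min B (1/y) = y^(σ-2) := by
    intro y hy
    have hy0 : 0 < y := hBi.trans hy
    rw [min_eq_right, show σ-2 = σ-1-1 by ring, Real.rpow_sub_one hy0.ne' (σ-1)]
    · ring
    · rw [div_le_iff₀ hy0]
      calc 1 = B * B⁻¹ := (mul_inv_cancel₀ hB.ne').symm
        _ ≤ _ := by gcongr; exact (Set.mem_Ioi.mp hy).le
  have b1 := a1.congr_fun (fun y hy => (e1 y hy).symm) measurableSet_Ioc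
  have b2 := a2.congr_fun (fun y hy => (e2 y hy).symm) measurableSet_Ioi
  refine ⟨by rw [hu]; exact b1.union b2, ?_⟩
  rw [hu, MeasureTheory.setIntegral_union Set.Ioc_disjoint_Ioi_same measurableSet_Ioi b1 b2,
    MeasureTheory.setIntegral_congr_fun measurableSet_Ioc e1, MeasureTheory.setIntegral_congr_fun measurableSet_Ioi e2,
    integral_Ioi_rpow_of_lt (by linarith) hBi, MeasureTheory.integral_mul_const, ← intervalIntegral.integral_of_le hBi.le,
    integral_rpow (Or.inl (by linarith))]
  apply le_of_eq
  rw [show σ - 1 + 1 = σ by ring, Real.zero_rpow h0.ne', show σ - 2 + 1 = -(1-σ) by ring, Real.inv_rpow hB.le, Real.inv_rpow hB.le,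
    Real.rpow_neg hB.le, inv_inv, Real.rpow_sub hB, Real.rpow_one]
  have : B^σ ≠ 0 := by positivity
  have : 1 - σ ≠ 0 := by linarith
  field_simp
  ring

lemma Phi_mellin_bound (j : ℕ) : ∀ (v : SchwartzMap ℝ ℂ), ∃ C : ℝ, 0 < C ∧ ∀ n N : ℕ, PP n N → ∀ s : ℂ, 1/4 ≤ s.re → s.re ≤ 3/4 →
    ‖s‖^j * ‖mellin (Phi n N v) s‖ ≤ C * (BB n N)^(1 - s.re) := by
  induction j with
  | zero =>
    intro v
    obtain ⟨C1, hC1, h1⟩ := Phi_bound1 v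
    obtain ⟨C2, hC2, h2⟩ := Phi_bound2 v
    refine ⟨(max C1 C2) * 8, by positivity, ?_⟩
    intro n N h s hs1 hs2
    rw [pow_zero, one_mul]
    have hB := BB_pos h
    obtain ⟨k1, k2⟩ := min_int hB (by linarith : 0 < s.re) (by linarith : s.re < 1)
    unfold mellin
    have hb : ∀ y ∈ Set.Ioi (0:ℝ), ‖(y:ℂ)^(s-1) • Phi n N v y‖ ≤ (max C1 C2) * (y^(s.re-1) * min (BB n N) (1/y)) := by
      intro y hy
      rw [norm_smul, Complex.norm_cpow_eq_rpow_re_of_pos hy, Complex.sub_re, Complex.one_re]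
      have hy' : 0 < y := hy
      have : ‖Phi n N v y‖ ≤ (max C1 C2) * min (BB n N) (1/y) := by
        rcases min_cases (BB n N) (1/y) with ⟨hm, _⟩ | ⟨hm, _⟩ <;> rw [hm]
        · exact (h2 n N h.1 h.2.1 h.2.2.1 h.2.2.2 y hy).trans (mul_le_mul_of_nonneg_right (le_max_right _ _) hB.le)
        · exact (h1 n N h.1 y hy).trans (mul_le_mul_of_nonneg_right (le_max_left _ _) (by positivity))
      calc _ ≤ y^(s.re-1) * ((max C1 C2) * min (BB n N) (1/y)) := by gcongr
        _ = _ := by ring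
    refine (MeasureTheory.norm_integral_le_of_norm_le (k1.const_mul _) ((MeasureTheory.ae_restrict_iff' measurableSet_Ioi).mpr (Filter.Eventually.of_forall hb))).trans ?_
    rw [MeasureTheory.integral_const_mul, mul_assoc]
    refine mul_le_mul_of_nonneg_left (k2.trans ?_) (by positivity)
    gcongr
    have : 1/s.re ≤ 1/(1/4) := by gcongr
    have : 1/(1-s.re) ≤ 1/(1/4) := by
      apply one_div_le_one_div_of_le <;> linarith
    linarith
  | succ j ih =>
    intro v
    obtain ⟨C, hC0, hC⟩ := ih (TT v)
    refine ⟨C, hC0, ?_⟩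
    intro n N h s hs1 hs2
    have := hC n N h s hs1 hs2
    rw [Phi_mellin_TT h v (by linarith) (by linarith), norm_mul, norm_neg] at this
    rw [pow_succ, mul_assoc]; exact this

lemma vert_integrable {f : ℂ → ℂ} {σ K : ℝ} (hf : ∀ t : ℝ, DifferentiableAt ℂ f (σ + t * Complex.I))
    (hK : ∀ t : ℝ, ‖f (σ + t * Complex.I)‖ ≤ K * (1 + t^2)⁻¹) :
    MeasureTheory.Integrable (fun t : ℝ => f (σ + t * Complex.I)) ∧
    ‖∫ t : ℝ, f (σ + t * Complex.I)‖ ≤ K * Real.pi := by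
  have hc : Continuous (fun t : ℝ => f (σ + t * Complex.I)) := by
    rw [continuous_iff_continuousAt]
    intro t
    exact ContinuousAt.comp (f := fun t : ℝ => (σ + t * Complex.I : ℂ)) (hf t).continuousAt (by fun_prop)
  have hi : MeasureTheory.Integrable (fun t : ℝ => K * (1 + t^2)⁻¹) := integrable_inv_one_add_sq.const_mul K
  refine ⟨hi.mono' hc.aestronglyMeasurable (Filter.Eventually.of_forall hK), ?_⟩
  refine (MeasureTheory.norm_integral_le_of_norm_le hi (Filter.Eventually.of_forall hK)).trans ?_
  rw [MeasureTheory.integral_const_mul, integral_univ_inv_one_add_sq]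

lemma contour_shift {f : ℂ → ℂ} {a b K : ℝ} (hab : a ≤ b)
    (hf : ∀ s : ℂ, a ≤ s.re → s.re ≤ b → DifferentiableAt ℂ f s)
    (hK : ∀ s : ℂ, a ≤ s.re → s.re ≤ b → ‖f s‖ ≤ K * (1 + s.im^2)⁻¹) :
    ∫ t : ℝ, f (a + t * Complex.I) = ∫ t : ℝ, f (b + t * Complex.I) := by
  have ia := (vert_integrable (f := f) (σ := a) (K := K) (fun t => hf _ (by simp) (by simpa)) (fun t => by
    simpa using hK (a + t * Complex.I) (by simp) (by simpa))).1
  have ib := (vert_integrable (f := f) (σ := b) (K := K) (fun t => hf _ (by simpa) (by simp)) (fun t => by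
    simpa using hK (b + t * Complex.I) (by simpa) (by simp))).1
  have ta := MeasureTheory.intervalIntegral_tendsto_integral ia Filter.tendsto_neg_atTop_atBot Filter.tendsto_id
  have tb := MeasureTheory.intervalIntegral_tendsto_integral ib Filter.tendsto_neg_atTop_atBot Filter.tendsto_id
  have hor : ∀ T : ℝ, ‖∫ x in a..b, f (x + T * Complex.I)‖ ≤ K * (1 + T^2)⁻¹ * |b - a| := by
    intro T
    refine intervalIntegral.norm_integral_le_of_norm_le_const ?_
    intro x hx
    rw [Set.uIoc_of_le hab] at hx
    simpa using hK (x + T * Complex.I) (by simpa using hx.1.le) (by simpa using hx.2)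
  have hT : Filter.Tendsto (fun T : ℝ => K * (1 + T^2)⁻¹ * |b - a|) Filter.atTop (nhds 0) := by
    have h1 : Filter.Tendsto (fun T : ℝ => 1 + T^2) Filter.atTop Filter.atTop :=
      Filter.tendsto_atTop_add_const_left _ _ (Filter.tendsto_pow_atTop (by norm_num))
    simpa using (h1.inv_tendsto_atTop.const_mul K).mul_const |b-a|
  have t1 : Filter.Tendsto (fun T : ℝ => ∫ x in a..b, f (x + T * Complex.I)) Filter.atTop (nhds 0) :=
    squeeze_zero_norm hor hT
  have t2 : Filter.Tendsto (fun T : ℝ => ∫ x in a..b, f (x + (-T : ℝ) * Complex.I)) Filter.atTop (nhds 0) :=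
    squeeze_zero_norm (fun T => by simpa using hor (-T)) hT
  have key : ∀ T : ℝ, ((∫ x in a..b, f (x + (-T : ℝ) * Complex.I)) - ∫ x in a..b, f (x + T * Complex.I))
     + Complex.I • (∫ t in (-T)..T, f (b + t * Complex.I)) - Complex.I • (∫ t in (-T)..T, f (a + t * Complex.I)) = 0 := by
    intro T
    have := Complex.integral_boundary_rect_eq_zero_of_differentiableOn f (⟨a, -T⟩ : ℂ) ⟨b, T⟩ (by
      intro s hs
      have h1 := hs.1
      simp only [Set.uIcc_of_le hab, Set.mem_preimage, Set.mem_Icc] at h1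
      exact (hf s h1.1 h1.2).differentiableWithinAt)
    exact this
  have lim := ((t2.sub t1).add (tb.const_smul Complex.I)).sub (ta.const_smul Complex.I)
  have lim0 := tendsto_nhds_unique lim (tendsto_const_nhds.congr (fun T => (key T).symm))
  simp only [sub_zero, zero_add, smul_eq_mul] at lim0
  rw [← mul_sub] at lim0
  have := (mul_eq_zero.mp lim0).resolve_left Complex.I_ne_zero
  exact (sub_eq_zero.mp this).symm

noncomputable def ck (q k : ℕ) : ℂ := if Nat.Coprime k q then ((ArithmeticFunction.moebius k : ℤ) : ℂ) else 0

noncomputable def EF (q : ℕ) (s : ℂ) : ℂ := (∏ p ∈ q.primeFactors, (1 - (p : ℂ) ^ (-s)))⁻¹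

lemma norm_ck_le (q k : ℕ) : ‖ck q k‖ ≤ 1 := by
  unfold ck
  split_ifs
  · rw [Complex.norm_intCast]
    exact_mod_cast ArithmeticFunction.abs_moebius_le_one
  · simp

lemma ck_LSeries {q : ℕ} (hq : q ≠ 0) {s : ℂ} (hs : 1 < s.re) :
    LSeries (ck q) s = iz s * EF q s := by
  have : NeZero q := ⟨hq⟩
  have hs1 : s ≠ 1 := by rintro rfl; simp at hs
  have h1 := DirichletCharacter.LSeries.mul_mu_eq_one (1 : DirichletCharacter ℂ q) hs
  rw [← DirichletCharacter.LFunction_eq_LSeries _ hs] at h1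
  have h2 : DirichletCharacter.LFunction (1 : DirichletCharacter ℂ q) s = _ := DirichletCharacter.LFunctionTrivChar_eq_mul_riemannZeta hs1
  rw [h2] at h1
  have h3 : ((fun n : ℕ => (1 : DirichletCharacter ℂ q) n) * fun n : ℕ => ((ArithmeticFunction.moebius n : ℤ) : ℂ)) = ck q := by
    ext k
    simp only [Pi.mul_apply, ck]
    split_ifs with h
    · rw [MulChar.one_apply ((ZMod.isUnit_iff_coprime k q).mpr h), one_mul]
    · rw [MulChar.map_nonunit _ (fun hu => h ((ZMod.isUnit_iff_coprime k q).mp hu)), zero_mul]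
  rw [h3] at h1
  rw [iz_eq hs1, EF, ← mul_inv, mul_comm (riemannZeta s)]
  exact eq_inv_of_mul_eq_one_right h1

lemma EF_fac {p : ℕ} (hp : 2 ≤ p) {s : ℂ} (hs : 1/2 ≤ s.re) : 1/4 ≤ ‖1 - (p:ℂ)^(-s)‖ := by
  have hp' : (2:ℝ) ≤ p := by exact_mod_cast hp
  have h1 : ‖(p:ℂ)^(-s)‖ ≤ 3/4 := by
    rw [Complex.norm_natCast_cpow_of_pos (by omega), Complex.neg_re]
    calc (p:ℝ)^(-s.re) ≤ (p:ℝ)^(-(1/2):ℝ) := Real.rpow_le_rpow_of_exponent_le (by linarith) (by linarith)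
      _ ≤ (2:ℝ)^(-(1/2):ℝ) := Real.rpow_le_rpow_of_nonpos (by norm_num) hp' (by norm_num)
      _ ≤ 3/4 := by
        rw [Real.rpow_neg (by norm_num), ← Real.sqrt_eq_rpow]
        rw [inv_le_comm₀ (by positivity) (by norm_num)]
        apply Real.le_sqrt_of_sq_le; norm_num
  have h2 := norm_sub_norm_le (1:ℂ) ((p:ℂ)^(-s))
  rw [norm_one] at h2
  linarith

lemma EF_diff (q : ℕ) {s : ℂ} (hs : 1/2 ≤ s.re) : DifferentiableAt ℂ (EF q) s := by
  unfold EF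
  refine DifferentiableAt.inv ?_ ?_
  · refine DifferentiableAt.fun_finsetProd fun p hp => ?_
    have : (p:ℂ) ≠ 0 := by exact_mod_cast (Nat.prime_of_mem_primeFactors hp).ne_zero
    exact (differentiableAt_const _).sub ((differentiableAt_id.neg).const_cpow (Or.inl this))
  · rw [Finset.prod_ne_zero_iff]
    intro p hp h0
    have := EF_fac (Nat.prime_of_mem_primeFactors hp).two_le hs
    rw [h0, norm_zero] at this
    norm_num at this

lemma EF_bound {q : ℕ} (hq : q ≠ 0) {s : ℂ} (hs : 1/2 ≤ s.re) : ‖EF q s‖ ≤ (q.divisors.card : ℝ)^2 := by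
  unfold EF
  rw [norm_inv, norm_prod, ← Finset.prod_inv_distrib]
  calc _ ≤ ∏ p ∈ q.primeFactors, (((q.factorization p : ℝ) + 1))^2 := by
        refine Finset.prod_le_prod (fun _ _ => by positivity) ?_
        intro p hp
        have h1 := EF_fac (Nat.prime_of_mem_primeFactors hp).two_le hs
        have h2 : 1 ≤ q.factorization p := by
          have := (Nat.prime_of_mem_primeFactors hp).factorization_pos_of_dvd hq (Nat.dvd_of_mem_primeFactors hp)
          omega
        have h3 : (1:ℝ) ≤ q.factorization p := by exact_mod_cast h2
        calc _ ≤ ((1:ℝ)/4)⁻¹ := inv_anti₀ (by norm_num) h1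
          _ ≤ _ := by nlinarith
    _ = _ := by
        rw [Nat.card_divisors hq, Finset.prod_pow]; push_cast; rfl

lemma cpow_id {k : ℕ} (hk : k ≠ 0) {X : ℝ} (hX : 0 < X) (s : ℂ) :
    (((k:ℝ)^2/X : ℝ) : ℂ)^(-s) = (X:ℂ)^s / (k:ℂ)^(2*s) := by
  have hX0 : (X:ℂ) ≠ 0 := by exact_mod_cast hX.ne'
  have hk0 : (k:ℂ) ≠ 0 := by exact_mod_cast hk
  rw [Complex.cpow_neg, show ((k:ℝ)^2/X) = ((k:ℝ)*k) * X⁻¹ by ring, Complex.ofReal_mul, Complex.mul_cpow_ofReal_nonneg (by positivity) (by positivity),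
    Complex.ofReal_mul, Complex.ofReal_natCast, Complex.natCast_mul_natCast_cpow, Complex.ofReal_inv, Complex.inv_cpow _ _ (by
      rw [Complex.arg_ofReal_of_nonneg hX.le]; exact Real.pi_pos.ne), two_mul, Complex.cpow_add _ _ hk0]
  field_simp

lemma strip_sq {s : ℂ} (hs : 1/4 ≤ s.re) : (1 + s.im^2)/16 ≤ ‖s‖^2 := by
  rw [Complex.sq_norm, Complex.normSq_apply]
  nlinarith [sq_nonneg s.im]

lemma main_analytic (hRH : RiemannHypothesis) (v : SchwartzMap ℝ ℂ) {δ : ℝ} (hδ : 0 < δ) (hδ2 : δ ≤ 1/4) :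
    ∃ C : ℝ, 0 < C ∧ ∀ n N : ℕ, PP n N → ∀ X : ℝ, 1 ≤ X →
      ‖∑' k : ℕ, ck (n*N) k * Phi n N v ((k:ℝ)^2/X)‖ ≤
        C * (((n*N).divisors.card : ℝ)^2 * (X^(1/4+δ) * (BB n N)^(1 - (1/4+δ)))) := by
  obtain ⟨C0, A, hC0, hiz⟩ := iz_bound hRH (δ := 2*δ) (by positivity)
  obtain ⟨C1, hC1, hM⟩ := Phi_mellin_bound (A+2) v
  obtain ⟨C2, hC2, hM2⟩ := Phi_mellin_bound 2 v
  refine ⟨16 * C1 * C0 * 6^A, by positivity, ?_⟩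
  intro n N h X hX
  have hX0 : 0 < X := by linarith
  have hXc : (X:ℂ) ≠ 0 := by exact_mod_cast hX0.ne'
  have hB := BB_pos h
  set q := n * N with hq
  have hq0 : q ≠ 0 := by have := h.1; have := h.2.2.2; positivity
  set M := mellin (Phi n N v) with hMdef
  set τ : ℝ := (q.divisors.card : ℝ) with hτ
  set H : ℂ → ℂ := fun s => (X:ℂ)^s * M s * (iz (2*s) * EF q (2*s)) with hH
  have hnX : ∀ s : ℂ, ‖(X:ℂ)^s‖ = X^s.re := fun s => Complex.norm_cpow_eq_rpow_re_of_pos hX0 s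
  have hHd : ∀ s : ℂ, 1/4+δ ≤ s.re → s.re ≤ 3/4 → DifferentiableAt ℂ H s := by
    intro s h1 h2
    have hre : (2*s).re = 2*s.re := by simp
    have d1 : DifferentiableAt ℂ (fun s : ℂ => (X:ℂ)^s) s := differentiableAt_id.const_cpow (Or.inl hXc)
    have d2 : DifferentiableAt ℂ M s := Phi_mellinDiff h v (by linarith) (by linarith)
    have d0 : DifferentiableAt ℂ (fun s : ℂ => 2*s) s := differentiableAt_id.const_mul 2
    have d3 : DifferentiableAt ℂ (fun s : ℂ => iz (2*s)) s :=
      DifferentiableAt.comp (g := iz) s (iz_diff hRH (by rw [hre]; linarith)) d0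
    have d4 : DifferentiableAt ℂ (fun s : ℂ => EF q (2*s)) s :=
      DifferentiableAt.comp (g := EF q) s (EF_diff q (by rw [hre]; linarith)) d0
    exact (d1.mul d2).mul (d3.mul d4)
  have hHb : ∀ s : ℂ, 1/4+δ ≤ s.re → s.re ≤ 3/4 →
      ‖H s‖ ≤ 16 * C1 * C0 * 6^A * (τ^2 * (X^s.re * (BB n N)^(1-s.re))) * (1 + s.im^2)⁻¹ := by
    intro s h1 h2
    have hre : (2*s).re = 2*s.re := by simp
    have hs4 : 1/4 ≤ ‖s‖ := le_trans (by linarith) (Complex.re_le_norm s)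
    have hs0 : 0 < ‖s‖ := by linarith
    have b1 := hiz (2*s) (by rw [hre]; linarith) (by rw [hre]; linarith)
    have b1' : ‖iz (2*s)‖ ≤ C0 * (6*‖s‖)^A := by
      refine b1.trans ?_
      gcongr
      rw [norm_mul, Complex.norm_two]; linarith
    have b2 := EF_bound hq0 (s := 2*s) (by rw [hre]; linarith)
    have b3 := hM n N h s (by linarith) h2
    have b3' : ‖M s‖ ≤ C1 * (BB n N)^(1-s.re) / ‖s‖^(A+2) := by
      rw [le_div_iff₀ (by positivity), mul_comm]; exact b3
    have b4 := strip_sq (s := s) (by linarith)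
    have b5 : (‖s‖^2)⁻¹ ≤ 16 * (1 + s.im^2)⁻¹ := by
      have := inv_anti₀ (by positivity) b4
      rwa [inv_div, div_eq_mul_inv] at this
    rw [hH]
    simp only [norm_mul, hnX]
    calc _ ≤ X^s.re * (C1 * (BB n N)^(1-s.re) / ‖s‖^(A+2)) * ((C0 * (6*‖s‖)^A) * τ^2) := by gcongr
      _ = (C1 * C0 * 6^A * (τ^2 * (X^s.re * (BB n N)^(1-s.re)))) * (‖s‖^2)⁻¹ := by
        rw [mul_pow, pow_add]; field_simp
      _ ≤ (C1 * C0 * 6^A * (τ^2 * (X^s.re * (BB n N)^(1-s.re)))) * (16 * (1 + s.im^2)⁻¹) := by gcongr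
      _ = _ := by ring
  have hshift : ∫ t : ℝ, H (((1/4+δ:ℝ):ℂ) + t * Complex.I) = ∫ t : ℝ, H (((3/4:ℝ):ℂ) + t * Complex.I) := by
    refine contour_shift (K := 16 * C1 * C0 * 6^A * (τ^2 * (X * (1 + BB n N)))) (by linarith) hHd ?_
    intro s h1 h2
    refine (hHb s h1 h2).trans ?_
    gcongr
    · calc X^s.re ≤ X^(1:ℝ) := Real.rpow_le_rpow_of_exponent_le hX (by linarith)
        _ = X := Real.rpow_one X
    · calc (BB n N)^(1-s.re) ≤ (1 + BB n N)^(1-s.re) := Real.rpow_le_rpow hB.le (by linarith) (by linarith)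
        _ ≤ (1 + BB n N)^(1:ℝ) := Real.rpow_le_rpow_of_exponent_le (by linarith) (by linarith)
        _ = _ := Real.rpow_one _
  -- vertical integrability at 3/4
  have hMv : MeasureTheory.Integrable (fun t : ℝ => M (((3/4:ℝ):ℂ) + t * Complex.I)) := by
    refine (vert_integrable (f := M) (K := 16 * C2 * (BB n N)^(1-(3/4:ℝ))) (fun t => ?_) (fun t => ?_)).1
    · exact Phi_mellinDiff h v (by simp) (by simp; norm_num)
    · set s : ℂ := ((3/4:ℝ):ℂ) + t * Complex.I with hs
      have hre : s.re = 3/4 := by simp [hs]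
      have him : s.im = t := by simp [hs]
      have b := hM2 n N h s (by rw [hre]; norm_num) (by rw [hre])
      have b4 := strip_sq (s := s) (by rw [hre]; norm_num)
      rw [him] at b4
      rw [hre] at b
      have : (1 + t^2)/16 * ‖M s‖ ≤ C2 * (BB n N)^(1-(3/4:ℝ)) := (mul_le_mul_of_nonneg_right b4 (norm_nonneg _)).trans b
      rw [← div_eq_mul_inv, le_div_iff₀ (by positivity)]
      linarith
  set S34 : ℝ → ℂ := fun t => ((3/4:ℝ):ℂ) + t * Complex.I with hS34
  have hSre : ∀ t, (S34 t).re = 3/4 := fun t => by simp [hS34]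
  have hcS : Continuous S34 := by rw [hS34]; fun_prop
  set F : ℕ → ℝ → ℂ := fun k t => LSeries.term (ck q) (2 * S34 t) k * ((X:ℂ)^(S34 t) * M (S34 t)) with hF
  have hXM : MeasureTheory.Integrable (fun t : ℝ => (X:ℂ)^(S34 t) * M (S34 t)) := by
    refine hMv.bdd_mul (c := X^(3/4:ℝ)) ?_ ?_
    · exact (Continuous.const_cpow hcS (Or.inl hXc)).aestronglyMeasurable
    · exact Filter.Eventually.of_forall fun t => by rw [hnX, hSre]
  have hterm : ∀ k t, ‖LSeries.term (ck q) (2 * S34 t) k‖ ≤ (k:ℝ)^(-(3/2):ℝ) := by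
    intro k t
    rcases eq_or_ne k 0 with rfl | hk
    · simp [LSeries.term_zero, Real.zero_rpow]
    · rw [LSeries.term_of_ne_zero hk, norm_div, Complex.norm_natCast_cpow_of_pos (Nat.pos_of_ne_zero hk)]
      have : (2 * S34 t).re = 3/2 := by
        have := hSre t
        simp only [Complex.mul_re, Complex.re_ofNat, Complex.im_ofNat, zero_mul, sub_zero, this]; norm_num
      rw [this, Real.rpow_neg (by positivity), ← one_div]
      gcongr
      exact norm_ck_le q k
  have hFint : ∀ k, MeasureTheory.Integrable (F k) := by
    intro k
    refine hXM.bdd_mul (c := (k:ℝ)^(-(3/2):ℝ)) ?_ (Filter.Eventually.of_forall (hterm k))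
    rcases eq_or_ne k 0 with rfl | hk
    · simp only [LSeries.term_zero]; fun_prop
    · have hk0 : (k:ℂ) ≠ 0 := by exact_mod_cast hk
      simp only [LSeries.term_of_ne_zero hk]
      refine (Continuous.div continuous_const (Continuous.const_cpow (by fun_prop) (Or.inl hk0)) ?_).aestronglyMeasurable
      intro t; simp [Complex.cpow_eq_zero_iff, hk0]
  have hFsum : Summable (fun k => ∫ t, ‖F k t‖) := by
    have hs : Summable (fun k : ℕ => (k:ℝ)^(-(3/2):ℝ) * ∫ t, ‖(X:ℂ)^(S34 t) * M (S34 t)‖) :=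
      (Real.summable_nat_rpow.mpr (by norm_num)).mul_right _
    refine Summable.of_nonneg_of_le (fun k => MeasureTheory.integral_nonneg fun _ => norm_nonneg _) ?_ hs
    intro k
    rw [← MeasureTheory.integral_const_mul]
    refine MeasureTheory.integral_mono (hFint k).norm (hXM.norm.const_mul _) ?_
    intro t
    simp only [hF]
    rw [norm_mul]
    gcongr
    exact hterm k t
  have hsum := MeasureTheory.hasSum_integral_of_summable_integral_norm hFint hFsum
  have e1 : ∀ t, ∑' k, F k t = H (S34 t) := by
    intro t
    simp only [hF]
    rw [tsum_mul_right]
    have hre : 1 < (2 * S34 t).re := by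
      have := hSre t
      simp only [Complex.mul_re, Complex.re_ofNat, Complex.im_ofNat, zero_mul, sub_zero, this]; norm_num
    have := ck_LSeries hq0 hre
    unfold LSeries at this
    rw [this, hH]; ring
  have e2 : ∀ k : ℕ, ck q k * Phi n N v ((k:ℝ)^2/X) = ((1/(2*Real.pi) : ℝ):ℂ) * ∫ t, F k t := by
    intro k
    rcases eq_or_ne k 0 with rfl | hk
    · simp [hF, LSeries.term_zero, ck]
    · have hkr : (0:ℝ) < k := by exact_mod_cast Nat.pos_of_ne_zero hk
      have hx : 0 < (k:ℝ)^2/X := by positivity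
      have := mellinInv_mellin_eq (3/4:ℝ) (Phi n N v) hx (Phi_mellinConv h v (by simp) (by simp; norm_num)) hMv
        (Phi_hasDerivAt h.1 N v hx).continuousAt
      rw [← this, mellinInv, Complex.real_smul, mul_left_comm, ← MeasureTheory.integral_const_mul]
      congr 2
      ext t
      simp only [hF, hS34]
      rw [cpow_id hk hX0, LSeries.term_of_ne_zero hk, smul_eq_mul]
      ring
  simp_rw [e1] at hsum
  simp_rw [e2]
  rw [tsum_mul_left, hsum.tsum_eq, ← hshift, norm_mul, Complex.norm_real, Real.norm_eq_abs, abs_of_pos (by positivity)]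
  have hfin := (vert_integrable (f := H) (σ := 1/4+δ) (K := 16 * C1 * C0 * 6^A * (τ^2 * (X^(1/4+δ) * (BB n N)^(1-(1/4+δ)))))
    (fun t => hHd _ (by simp) (by simp; linarith)) (fun t => by
      have := hHb (((1/4+δ:ℝ):ℂ) + t * Complex.I) (by simp) (by simp; linarith)
      have hre : (((1/4+δ:ℝ):ℂ) + t * Complex.I).re = 1/4+δ := by simp
      have him : (((1/4+δ:ℝ):ℂ) + t * Complex.I).im = t := by simp
      rw [hre, him] at this
      exact this)).2
  have hK0 : 0 ≤ 16 * C1 * C0 * 6^A * (τ^2 * (X^(1/4+δ) * (BB n N)^(1-(1/4+δ)))) := by positivity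
  calc _ ≤ 1/(2*Real.pi) * (16 * C1 * C0 * 6^A * (τ^2 * (X^(1/4+δ) * (BB n N)^(1-(1/4+δ)))) * Real.pi) := by gcongr
    _ = (16 * C1 * C0 * 6^A * (τ^2 * (X^(1/4+δ) * (BB n N)^(1-(1/4+δ))))) * (1/2) := by
      have := Real.pi_pos
      field_simp
    _ ≤ _ := by linarith

lemma sq_dvd_aux {k b a : ℕ} (hb : b ≠ 0) (ha : Squarefree a) : k^2 ∣ b^2 * a ↔ k ∣ b := by
  constructor
  · intro h
    obtain ⟨g, k', b', hg, hcop, hk, hb'⟩ := Nat.exists_coprime' (m := k) (n := b) (Nat.gcd_pos_of_pos_right _ (Nat.pos_of_ne_zero hb))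
    rw [hk, hb', mul_pow, mul_pow, mul_comm (k'^2), mul_comm (b'^2), mul_assoc] at h
    have h2 := Nat.dvd_of_mul_dvd_mul_left (by positivity) h
    have h3 : k'^2 ∣ a := (Nat.Coprime.pow 2 2 hcop).dvd_of_dvd_mul_left h2
    have h4 : IsUnit k' := ha k' (by rwa [← sq])
    rw [Nat.isUnit_iff] at h4
    rw [hk, hb', h4, one_mul]
    exact Dvd.intro_left _ rfl
  · intro h
    exact Dvd.dvd.mul_right (pow_dvd_pow_of_dvd h 2) a

lemma sqfree_sum {d : ℤ} (hd : d ≠ 0) :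
    ∑' k : ℕ, (if ((k^2 : ℕ) : ℤ) ∣ d then ((ArithmeticFunction.moebius k : ℤ) : ℂ) else 0) = if Squarefree d then 1 else 0 := by
  obtain ⟨a, b, hab, ha⟩ := Nat.sq_mul_squarefree d.natAbs
  have hb : b ≠ 0 := by
    rintro rfl
    simp at hab
    omega
  have h1 : ∀ k : ℕ, (((k^2 : ℕ) : ℤ) ∣ d) ↔ k ∣ b := by
    intro k
    rw [Int.natCast_dvd, ← hab, sq_dvd_aux hb ha]
  simp_rw [h1]
  rw [tsum_eq_sum (s := b.divisors) (by
    intro k hk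
    rw [if_neg]
    intro h; exact hk (Nat.mem_divisors.mpr ⟨h, hb⟩))]
  rw [Finset.sum_congr rfl (g := fun k => ((ArithmeticFunction.moebius k : ℤ) : ℂ)) (fun k hk => by
    rw [if_pos (Nat.dvd_of_mem_divisors hk)]), sum_moebius_eq]
  have h2 : b = 1 ↔ Squarefree d := by
    rw [← Int.squarefree_natAbs]
    constructor
    · rintro rfl; rw [← hab]; simpa using ha
    · intro h
      have := h b (by rw [← hab, ← sq]; exact Dvd.intro _ rfl)
      rwa [Nat.isUnit_iff] at this
  simp only [h2]

lemma psi_sq {n N : ℕ} (hn : 0 < n) (k : ℕ) (e : ℤ) :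
    ((ArithmeticFunction.moebius k : ℤ) : ℂ) * psi n N (((k^2 : ℕ) : ℤ) * e) = ck (n*N) k * psi n N e := by
  have : NeZero n := ⟨hn.ne'⟩
  unfold psi ck
  have e1 : Int.gcd (((k^2 : ℕ) : ℤ) * e) N = 1 ↔ Nat.Coprime k N ∧ Int.gcd e N = 1 := by
    rw [Int.gcd_def, Int.gcd_def, Int.natAbs_mul, Int.natAbs_natCast, Int.natAbs_natCast]
    change Nat.Coprime _ _ ↔ _ ∧ Nat.Coprime _ _
    rw [Nat.coprime_mul_iff_left, Nat.coprime_pow_left_iff (by norm_num)]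
  have e2 : jacobiSym (((k^2 : ℕ) : ℤ) * e) n = (if Nat.Coprime k n then 1 else 0) * jacobiSym e n := by
    rw [jacobiSym.mul_left]
    congr 1
    push_cast
    split_ifs with h
    · exact jacobiSym.sq_one' (by rw [Int.gcd_natCast_natCast]; exact h)
    · rw [jacobiSym.pow_left, jacobiSym.eq_zero_iff_not_coprime.mpr (by rw [Int.gcd_natCast_natCast]; exact h)]; norm_num
  simp only [e1, e2, Nat.coprime_mul_iff_right]
  split_ifs <;> first | (exfalso; tauto) | (push_cast; ring)

lemma decomp {n N : ℕ} (h : PP n N) (v : SchwartzMap ℝ ℂ) {X : ℝ} (hX : 0 < X) :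
    ∑' d : ℤ, (if Squarefree d then psi n N d * v (d * X⁻¹) else 0) = ∑' k : ℕ, ck (n*N) k * Phi n N v ((k:ℝ)^2/X) := by
  set f : ℕ → ℤ → ℂ := fun k d => if ((k^2 : ℕ) : ℤ) ∣ d then ((ArithmeticFunction.moebius k : ℤ) : ℂ) * psi n N d * v (d * X⁻¹) else 0 with hf
  have hn0 : 0 < n := by have := h.1; omega
  have hf0 : ∀ d, f 0 d = 0 := by intro d; simp [hf]
  have hinj : ∀ k : ℕ, k ≠ 0 → Function.Injective (fun e : ℤ => ((k^2 : ℕ) : ℤ) * e) := by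
    intro k hk a b hab
    exact mul_left_cancel₀ (by exact_mod_cast pow_ne_zero 2 hk) hab
  have hfe : ∀ k : ℕ, ∀ e : ℤ, f k (((k^2 : ℕ) : ℤ) * e) = ck (n*N) k * (psi n N e * v (e * ((k:ℝ)^2/X))) := by
    intro k e
    simp only [hf]
    rw [if_pos (Dvd.intro _ rfl), psi_sq hn0, mul_assoc]
    have : ((((k^2 : ℕ) : ℤ) * e : ℤ) : ℝ) * X⁻¹ = e * ((k:ℝ)^2/X) := by push_cast; ring
    rw [this]
  have hsupp : ∀ k : ℕ, ∀ d : ℤ, d ∉ Set.range (fun e : ℤ => ((k^2 : ℕ) : ℤ) * e) → f k d = 0 := by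
    intro k d hd
    simp only [hf]
    rw [if_neg]
    rintro ⟨e, he⟩
    exact hd ⟨e, he.symm⟩
  obtain ⟨C, hC0, hC⟩ := schwartz_sum v
  have hbe : ∀ k : ℕ, k ≠ 0 → ∀ e : ℤ, ‖f k (((k^2 : ℕ) : ℤ) * e)‖ ≤ C * uy ((k:ℝ)^2/X) e := by
    intro k hk e
    have hkr : (0:ℝ) < k := by exact_mod_cast Nat.pos_of_ne_zero hk
    rw [hfe, norm_mul, norm_mul]
    by_cases he : e = 0
    · subst he; simp [psi_zero h.1, uy]
    · calc _ ≤ 1 * (1 * (C * uy ((k:ℝ)^2/X) e)) := by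
            have := norm_ck_le (n*N) k
            have := norm_psi_le n N e
            have := hC _ (by positivity : 0 < (k:ℝ)^2/X) e he
            gcongr
        _ = _ := by ring
  have hsk : ∀ k : ℕ, Summable (fun d => ‖f k d‖) ∧ ∑' d, ‖f k d‖ ≤ 2 * C * X * (1 / (k:ℝ)^2) := by
    intro k
    rcases eq_or_ne k 0 with rfl | hk
    · simp only [hf0, norm_zero]
      refine ⟨summable_zero, by simp⟩
    · have hkr : (0:ℝ) < k := by exact_mod_cast Nat.pos_of_ne_zero hk
      obtain ⟨u1, u2⟩ := uy_sum (by positivity : 0 < (k:ℝ)^2/X)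
      have s1 : Summable (fun e : ℤ => ‖f k (((k^2 : ℕ) : ℤ) * e)‖) :=
        Summable.of_nonneg_of_le (fun _ => norm_nonneg _) (hbe k hk) (u1.mul_left C)
      have s2 : Summable (fun d => ‖f k d‖) :=
        ((hinj k hk).summable_iff (f := fun d => ‖f k d‖) (fun d hd => by rw [hsupp k d hd, norm_zero])).mp s1
      refine ⟨s2, ?_⟩
      rw [← (hinj k hk).tsum_eq (f := fun d => ‖f k d‖) (by
        intro d hd
        by_contra hc
        exact hd (by simp [hsupp k d hc]))]
      refine (Summable.tsum_le_tsum (hbe k hk) s1 (u1.mul_left C)).trans ?_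
      rw [tsum_mul_left]
      calc _ ≤ C * (2 / ((k:ℝ)^2/X)) := by gcongr
        _ = _ := by field_simp
  have hsumm : Summable (Function.uncurry f) := by
    refine Summable.of_norm ?_
    rw [summable_prod_of_nonneg (fun _ => norm_nonneg _)]
    refine ⟨fun k => (hsk k).1, ?_⟩
    refine Summable.of_nonneg_of_le (fun _ => tsum_nonneg fun _ => norm_nonneg _) (fun k => (hsk k).2) ?_
    exact (Real.summable_one_div_nat_pow.mpr (by norm_num)).mul_left _
  have hL : ∀ d : ℤ, (if Squarefree d then psi n N d * v (d * X⁻¹) else 0) = ∑' k, f k d := by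
    intro d
    rcases eq_or_ne d 0 with rfl | hd
    · simp only [hf, psi_zero h.1]; simp
    · have := sqfree_sum hd
      rw [← mul_one (psi n N d * v (d * X⁻¹)), ← mul_zero (psi n N d * v (d * X⁻¹)), ← mul_ite, ← this, ← tsum_mul_left]
      refine tsum_congr fun k => ?_
      simp only [hf]
      split_ifs
      · ring
      · simp
  have hR : ∀ k : ℕ, ck (n*N) k * Phi n N v ((k:ℝ)^2/X) = ∑' d, f k d := by
    intro k
    rcases eq_or_ne k 0 with rfl | hk
    · simp [hf0, ck]
    · rw [← (hinj k hk).tsum_eq (f := f k) (by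
        intro d hd
        by_contra hc
        exact hd (hsupp k d hc))]
      simp_rw [hfe]
      rw [tsum_mul_left]; rfl
  simp_rw [hL, hR]
  exact Summable.tsum_comm hsumm

/-- Under RH, the squarefree character sum with smooth weight `w` and
non-square odd modulus `n` satisfies `∑*_{(d,N)=1} w(d/X)(d|n) ≪_{ε,w} N^ε n^{3/8+ε} X^{1/4+ε}`. -/
theorem squarefree_char_sum_nonsquare (hRH : RiemannHypothesis) (w : SchwartzMap ℝ ℝ)
    (heven : ∀ x : ℝ, w (-x) = w x) :
    ∀ ε : ℝ, 0 < ε → ∃ C : ℝ, 0 < C ∧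
      ∀ N : ℕ, 0 < N → ∀ X : ℝ, 1 ≤ X → ∀ n : ℕ, Odd n → 0 < n → ¬ IsSquare n →
        |∑' d : ℤ, if Squarefree d ∧ Int.gcd d N = 1
            then w ((d : ℝ) / X) * (jacobiSym d n : ℝ) else 0|
          ≤ C * (N : ℝ) ^ ε * (n : ℝ) ^ ((3 : ℝ) / 8 + ε) * X ^ ((1 : ℝ) / 4 + ε) := by
  intro ε hε
  obtain ⟨C, hC0, hC⟩ := main_analytic hRH (w.postcompCLM Complex.ofRealCLM) (δ := min ε (1/4))
    (lt_min hε (by norm_num)) (min_le_right _ _)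
  obtain ⟨D, hD0, hD⟩ := divisor_bound (ε := ε/3) (by positivity)
  refine ⟨C * D^3, by positivity, ?_⟩
  intro N hN X hX n hodd hn0 hsq
  have hn1 : 1 < n := by
    rcases Nat.lt_or_ge 1 n with h | h
    · exact h
    · exact absurd (⟨1, by omega⟩ : IsSquare n) hsq
  have hP : PP n N := ⟨hn1, hodd, hsq, hN⟩
  have hX0 : 0 < X := by linarith
  have e1 : ((∑' d : ℤ, if Squarefree d ∧ Int.gcd d N = 1
            then w ((d : ℝ) / X) * (jacobiSym d n : ℝ) else 0 : ℝ) : ℂ)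
      = ∑' d : ℤ, (if Squarefree d then psi n N d * (w.postcompCLM Complex.ofRealCLM) (d * X⁻¹) else 0) := by
    rw [Complex.ofReal_tsum]
    refine tsum_congr fun d => ?_
    unfold psi
    rw [SchwartzMap.postcompCLM_apply, div_eq_mul_inv]
    by_cases h1 : Squarefree d <;> by_cases h2 : Int.gcd d N = 1 <;> simp [h1, h2, mul_comm]
  have e2 := hC n N hP X hX
  rw [← decomp hP _ hX0, ← e1, Complex.norm_real, Real.norm_eq_abs] at e2
  refine e2.trans ?_
  set δ := min ε (1/4) with hδ
  have hδ0 : 0 < δ := lt_min hε (by norm_num)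
  have hδ1 : δ ≤ 1/4 := min_le_right _ _
  have hδ2 : δ ≤ ε := min_le_left _ _
  set τ : ℝ := ((n*N).divisors.card : ℝ) with hτ
  have hnN : 0 < n * N := by positivity
  have hτ1 : 1 ≤ τ := by
    rw [hτ]
    exact_mod_cast Finset.card_pos.mpr ⟨1, Nat.mem_divisors.mpr ⟨one_dvd _, hnN.ne'⟩⟩
  have hnr : (1:ℝ) ≤ n := by exact_mod_cast hn0
  have hnr0 : (0:ℝ) < n := by linarith
  have hNr : (0:ℝ) < N := by exact_mod_cast hN
  have hB : (BB n N)^(1-(1/4+δ)) ≤ (n:ℝ)^((3:ℝ)/8) * τ := by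
    unfold BB
    rw [Real.mul_rpow (by positivity) (by positivity)]
    have a1 : (Real.sqrt n)^(1-(1/4+δ)) ≤ (n:ℝ)^((3:ℝ)/8) := by
      rw [Real.sqrt_eq_rpow, ← Real.rpow_mul (by positivity)]
      exact Real.rpow_le_rpow_of_exponent_le hnr (by linarith)
    have a2 : τ^(1-(1/4+δ)) ≤ τ := by
      calc τ^(1-(1/4+δ)) ≤ τ^(1:ℝ) := Real.rpow_le_rpow_of_exponent_le hτ1 (by linarith)
        _ = τ := Real.rpow_one _
    exact mul_le_mul a1 a2 (by positivity) (by positivity)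
  have hXX : X^(1/4+δ) ≤ X^((1:ℝ)/4+ε) := Real.rpow_le_rpow_of_exponent_le hX (by linarith)
  have hτ3 : τ^3 ≤ D^3 * ((n:ℝ)^ε * (N:ℝ)^ε) := by
    calc τ^3 ≤ (D * ((n*N : ℕ):ℝ)^(ε/3))^3 := by
          have := hD (n*N) hnN
          gcongr
      _ = _ := by
          rw [mul_pow, ← Real.rpow_natCast (_ ^ (ε/3)), ← Real.rpow_mul (by positivity)]
          push_cast
          rw [div_mul_cancel₀ _ (by norm_num), Real.mul_rpow (by positivity) (by positivity)]
  calc C * (τ^2 * (X^(1/4+δ) * (BB n N)^(1-(1/4+δ))))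
      ≤ C * (τ^2 * (X^((1:ℝ)/4+ε) * ((n:ℝ)^((3:ℝ)/8) * τ))) := by
          have := Real.rpow_nonneg (BB_pos hP).le (1-(1/4+δ))
          gcongr
    _ = C * (X^((1:ℝ)/4+ε) * (n:ℝ)^((3:ℝ)/8)) * τ^3 := by ring
    _ ≤ C * (X^((1:ℝ)/4+ε) * (n:ℝ)^((3:ℝ)/8)) * (D^3 * ((n:ℝ)^ε * (N:ℝ)^ε)) := by gcongr
    _ = _ := by rw [Real.rpow_add hnr0]; ring
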